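/- arXiv:0805.0154 — 2 statements merged into one kernel-verified Lean document; each statement's English description precedes it below -/
import Mathlib

section
/- If a and b are left-computable real numbers, then there exists c ∈ ℕ such that K(a_n) ≤ K((a+b)_n) + c for all n ∈ ℕ⁺, where x_n denotes the first n bits of the binary expansion of x mod 1 and K is prefix-free Kolmogorov complexity. -/
open Filter Topology

namespace Paper

/-- Finite binary strings. -/
abbrev Str := List Bool

/-- A computer: a partial recursive function on binary strings with prefix-free domain. -/
structure Computer where
  f : Str →. Str
  partrec : Partrec f
  prefixFree : ∀ p q : Str, (f p).Dom → (f q).Dom → p <+: q → p = q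

/-- An optimal computer (universal self-delimiting Turing machine). -/
structure OptimalComputer extends Computer where
  optimal : ∀ C : Computer, ∃ sim : ℕ, ∀ p s, s ∈ C.f p →
    ∃ p', s ∈ toComputer.f p' ∧ p'.length ≤ p.length + sim

/-- Prefix-free Kolmogorov complexity (program-size complexity) w.r.t. `U`. -/
noncomputable def Kc (U : OptimalComputer) (s : Str) : ℕ :=
  sInf {n | ∃ p : Str, p.length = n ∧ s ∈ U.f p}

/-- A semi-measure on binary strings: values in [0,1] with all finite partial sums ≤ 1. -/
def SemiMeasure (r : Str → ℝ) : Prop :=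
  (∀ s, 0 ≤ r s ∧ r s ≤ 1) ∧ ∀ F : Finset Str, ∑ s ∈ F, r s ≤ 1

/-- Lower-computability: approximability from below by a total recursive rational function. -/
def LowerComputable (r : Str → ℝ) : Prop :=
  ∃ f : ℕ → Str → ℚ, Computable₂ f ∧
    ∀ s : Str, (∀ n : ℕ, 0 ≤ f n s ∧ (f n s : ℝ) ≤ r s) ∧
      Tendsto (fun n => (f n s : ℝ)) atTop (nhds (r s))

/-- A lower-computable semi-measure. -/
def LCSemiMeasure (r : Str → ℝ) : Prop := SemiMeasure r ∧ LowerComputable r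

/-- A universal probability: a lower-computable semi-measure dominating all
lower-computable semi-measures up to a positive multiplicative constant. -/
def UniversalProb (m : Str → ℝ) : Prop :=
  LCSemiMeasure m ∧ ∀ r : Str → ℝ, LCSemiMeasure r → ∃ c : ℝ, 0 < c ∧ ∀ s, c * r s ≤ m s

/-- The first `n` bits of the base-two expansion of `T mod 1`
(the expansion with infinitely many zeros). -/
noncomputable def binPrefix (T : ℝ) (n : ℕ) : Str :=
  (List.range n).map (fun i => decide (⌊Int.fract T * 2 ^ (i + 1)⌋ % 2 = 1))

/-- A real is right-computable if it is the limit from above of a recursive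
sequence of rationals. -/
def RightComputableReal (T : ℝ) : Prop :=
  ∃ g : ℕ → ℚ, Computable g ∧ (∀ n, T ≤ (g n : ℝ)) ∧
    Tendsto (fun n => (g n : ℝ)) atTop (nhds T)

/-- A real is left-computable if its negation is right-computable. -/
def LeftComputableReal (T : ℝ) : Prop := RightComputableReal (-T)

/-- A computable real number. -/
def ComputableReal (T : ℝ) : Prop :=
  ∃ f : ℕ → ℚ, Computable f ∧ ∀ n : ℕ, |T - (f n : ℝ)| < (2 : ℝ)⁻¹ ^ n

/-- A recursively enumerable set of binary strings. -/
def REset (A : Set Str) : Prop :=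
  ∃ g : Str →. Unit, Partrec g ∧ ∀ s, (g s).Dom ↔ s ∈ A

/-- `T` is weakly Chaitin `D`-random. -/
noncomputable def WeaklyChaitinDRandom (U : OptimalComputer) (D T : ℝ) : Prop :=
  ∃ c : ℕ, ∀ n : ℕ, D * n - c ≤ Kc U (binPrefix T n)

/-- `T` is `D`-compressible. -/
noncomputable def DCompressible (U : OptimalComputer) (D T : ℝ) : Prop :=
  Filter.atTop.limsup (fun n : ℕ => (Kc U (binPrefix T n) : ℝ) / n) ≤ D


/-! ### Computability of the encoding of the rationals -/

/-- Minimisation of a computable total search is computable. -/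
theorem computable_of_search {α : Type*} [Primcodable α] {P : α → ℕ → Bool} (hP : Computable₂ P)
    {f : α → ℕ} (h1 : ∀ a, P a (f a) = true) (h2 : ∀ a m, m < f a → P a m = false) :
    Computable f := by
  have h : Partrec fun a => Nat.rfind fun n => (Part.some (P a n) : Part Bool) :=
    Partrec.rfind (p := fun a n => (Part.some (P a n) : Part Bool)) hP
  refine h.of_eq_tot fun a => ?_
  refine Nat.mem_rfind.2 ⟨by simp [h1], fun {m} hm => by simp [h2 a m hm]⟩

theorem computable_subtype_ofNat (s : Set ℕ) [DecidablePred (· ∈ s)] [Infinite s]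
    (hs : PrimrecPred (· ∈ s)) :
    Computable (fun n => (Nat.Subtype.ofNat s n : ℕ)) := by
  have hP : Primrec fun n => decide (n ∈ s) := primrecPred_iff_primrec_decide.1 hs
  have hex : ∀ x : ℕ, ∃ m, x + m + 1 ∈ s := by
    intro x
    obtain ⟨y, hy, hxy⟩ := (Set.infinite_coe_iff.1 (inferInstance : Infinite s)).exists_gt x
    exact ⟨y - x - 1, by rwa [show x + (y - x - 1) + 1 = y by omega]⟩
  have hfind : Computable (fun x => Nat.find (hex x)) := by
    refine computable_of_search (P := fun x m => decide (x + m + 1 ∈ s)) ?_ ?_ ?_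
    · exact (hP.comp (Primrec.succ.comp (Primrec.nat_add.comp Primrec.fst Primrec.snd))).to_comp
    · intro a
      simpa using Nat.find_spec (hex a)
    · intro a m hm
      simpa using Nat.find_min (hex a) hm
  have hstep : Computable₂ fun (_ : ℕ) (p : ℕ × ℕ) => p.2 + Nat.find (hex p.2) + 1 := by
    have : Computable fun x => x + Nat.find (hex x) + 1 :=
      Computable.succ.comp (Primrec.nat_add.to_comp.comp Computable.id hfind)
    exact (this.comp (Computable.snd.comp Computable.snd)).to₂
  have := Computable.nat_rec (f := fun n : ℕ => n) Computable.id
    (Computable.const ((⊥ : s) : ℕ)) hstep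
  refine this.of_eq fun n => ?_
  induction n with
  | zero => rfl
  | succ n ih =>
    simp only at ih ⊢
    rw [ih]
    rfl

/-- Code of a rational as a pair numerator-code / denominator. -/
def rawc (q : ℚ) : ℕ := @Encodable.encode ℚ Rat.instEncodable q

/-- natural number coding an integer -/
def intc : ℤ → ℕ
  | Int.ofNat n => 2 * n
  | Int.negSucc n => 2 * n + 1

theorem rawc_eq (q : ℚ) : rawc q = Nat.pair (intc q.num) q.den := by
  have h : rawc q = Nat.pair (Encodable.encode q.num) q.den := rfl
  rw [h]
  congr 1
  cases q.num <;> rfl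

theorem intc_abs (z : ℤ) : z.natAbs = (intc z + 1) / 2 := by
  cases z <;> simp [intc] <;> omega

theorem intc_surj (u : ℕ) : ∃ z, intc z = u := by
  rcases Nat.even_or_odd' u with ⟨k, h | h⟩
  · exact ⟨Int.ofNat k, h.symm⟩
  · exact ⟨Int.negSucc k, h.symm⟩

theorem mem_range_rawc (m : ℕ) : m ∈ Set.range rawc ↔
    0 < m.unpair.2 ∧ ∀ x < (m.unpair.1 + 1) / 2 + m.unpair.2 + 1,
      (((m.unpair.1 + 1) / 2) % x = 0 ∧ m.unpair.2 % x = 0) → x = 1 := by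
  constructor
  · rintro ⟨q, rfl⟩
    rw [rawc_eq, Nat.unpair_pair]
    refine ⟨q.pos, fun x _ hx => ?_⟩
    simp only [← intc_abs] at hx
    have := q.reduced
    exact Nat.eq_one_of_dvd_coprimes this (Nat.dvd_of_mod_eq_zero hx.1) (Nat.dvd_of_mod_eq_zero hx.2)
  · rintro ⟨h0, h⟩
    obtain ⟨z, hz⟩ := intc_surj m.unpair.1
    rw [← hz, ← intc_abs] at h
    have hc : z.natAbs.Coprime m.unpair.2 := by
      refine h _ ?_ ⟨?_, ?_⟩
      · have := Nat.gcd_le_right z.natAbs h0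
        omega
      · exact Nat.mod_eq_zero_of_dvd (Nat.gcd_dvd_left _ _)
      · exact Nat.mod_eq_zero_of_dvd (Nat.gcd_dvd_right _ _)
    refine ⟨⟨z, m.unpair.2, h0.ne', hc⟩, ?_⟩
    rw [rawc_eq]
    simp [hz]

theorem primrec_mem_range_rawc : PrimrecPred (· ∈ Set.range rawc) := by
  have hrel : PrimrecRel fun (x : ℕ) (m : ℕ) =>
      (((m.unpair.1 + 1) / 2) % x = 0 ∧ m.unpair.2 % x = 0) → x = 1 := by
    have hA : Primrec fun p : ℕ × ℕ => (((p.2.unpair.1 + 1) / 2) % p.1) :=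
      Primrec.nat_mod.comp (Primrec.nat_div.comp (Primrec.succ.comp
        (Primrec.fst.comp (Primrec.unpair.comp Primrec.snd))) (Primrec.const 2)) Primrec.fst
    have hB : Primrec fun p : ℕ × ℕ => p.2.unpair.2 % p.1 :=
      Primrec.nat_mod.comp
        (Primrec.snd.comp (Primrec.unpair.comp Primrec.snd)) Primrec.fst
    have h1 := Primrec.eq.comp hA (Primrec.const 0)
    have h2 := Primrec.eq.comp hB (Primrec.const 0)
    have h3 := Primrec.eq.comp (Primrec.fst (α := ℕ) (β := ℕ)) (Primrec.const 1)
    refine PrimrecPred.of_eq (((h1.and h2).not).or h3) fun p => ?_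
    simp only [imp_iff_not_or]
  have hb : Primrec fun m : ℕ => (m.unpair.1 + 1) / 2 + m.unpair.2 + 1 :=
    Primrec.succ.comp (Primrec.nat_add.comp (Primrec.nat_div.comp (Primrec.succ.comp
        (Primrec.fst.comp Primrec.unpair)) (Primrec.const 2))
        (Primrec.snd.comp Primrec.unpair))
  have hall := hrel.forall_lt.comp hb Primrec.id
  have hpos := Primrec.nat_lt.comp (Primrec.const 0) (Primrec.snd.comp Primrec.unpair)
  exact (hpos.and hall).of_eq fun m => (mem_range_rawc m).symm

theorem computable_rawc : Computable rawc := by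
  let := @Encodable.decidableRangeEncode ℚ Rat.instEncodable
  let hinf : Infinite (Set.range (@Encodable.encode ℚ Rat.instEncodable)) :=
    Infinite.of_injective _
      (Equiv.ofInjective _ (@Encodable.encode_injective ℚ Rat.instEncodable)).injective
  have h := computable_subtype_ofNat (Set.range (@Encodable.encode ℚ Rat.instEncodable))
    primrec_mem_range_rawc
  refine (h.comp Computable.encode).of_eq fun q => ?_
  have key : ∀ n, rawc (Denumerable.ofNat ℚ n) =
      Nat.Subtype.ofNat (Set.range (@Encodable.encode ℚ Rat.instEncodable)) n := by
    intro n
    have h1 : Denumerable.ofNat ℚ n = (@Encodable.equivRangeEncode ℚ Rat.instEncodable).symm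
        (Nat.Subtype.ofNat (Set.range (@Encodable.encode ℚ Rat.instEncodable)) n) := by
      rfl
    rw [h1]
    exact congrArg Subtype.val ((@Encodable.equivRangeEncode ℚ Rat.instEncodable).apply_symm_apply _)
  rw [← key, Denumerable.ofNat_encode]

/-! ### Kolmogorov complexity -/

theorem exists_program (U : OptimalComputer) (s : Str) : ∃ p, s ∈ U.f p := by
  have hpr : Partrec fun p : Str => bif decide (p = []) then Part.some s else Part.none := by
    refine Partrec.cond ?_ (Computable.const s) Partrec.none
    exact (Primrec.eq.decide.comp Primrec.id (Primrec.const [])).to_comp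
  have hdom : ∀ p : Str, (bif decide (p = []) then Part.some s else Part.none).Dom → p = [] := by
    intro p hp
    by_contra h
    simp [h] at hp
  let C : Computer :=
    { f := fun p : Str => bif decide (p = []) then Part.some s else Part.none
      partrec := hpr
      prefixFree := fun p q hp hq _ => by rw [hdom p hp, hdom q hq] }
  obtain ⟨sim, h⟩ := U.optimal C
  obtain ⟨pb, hp', -⟩ := h [] s (by simp [C])
  exact ⟨pb, hp'⟩

/-- Complexity does not grow (up to a constant) under partial recursive maps. -/
theorem Kc_le_of_partrec (U : OptimalComputer) (F : Str →. Str) (hF : Partrec F) :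
    ∃ c : ℕ, ∀ s t, t ∈ F s → Kc U t ≤ Kc U s + c := by
  let C : Computer :=
    { f := fun p => (U.f p).bind F
      partrec := U.partrec.bind (hF.comp Computable.snd).to₂
      prefixFree := fun p q hp hq h => U.prefixFree p q hp.1 hq.1 h }
  obtain ⟨c, hc⟩ := U.optimal C
  refine ⟨c, fun s t hst => ?_⟩
  have hne : {n | ∃ p : Str, p.length = n ∧ s ∈ U.f p}.Nonempty := by
    obtain ⟨p, hp⟩ := exists_program U s
    exact ⟨_, p, rfl, hp⟩
  obtain ⟨p, hpl, hp⟩ := Nat.sInf_mem hne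
  obtain ⟨pb, hp', hl⟩ := hc p t (Part.mem_bind hp hst)
  calc Kc U t ≤ pb.length := Nat.sInf_le ⟨pb, rfl, hp'⟩
    _ ≤ p.length + c := hl
    _ = Kc U s + c := by rw [hpl]; rfl

/-! ### Left-computable reals via natural number fractions -/

theorem exists_nat_approx {a : ℝ} (ha : LeftComputableReal a) :
    ∃ (N : ℕ) (p q : ℕ → ℕ), Computable p ∧ Computable q ∧ 0 ≤ a + N ∧ (∀ k, 0 < q k) ∧
      (∀ k, (p k : ℝ) / q k ≤ a + N) ∧
      Tendsto (fun k => (p k : ℝ) / q k) atTop (𝓝 (a + N)) := by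
  obtain ⟨g, hg, hle, hlim⟩ := ha
  obtain ⟨N, hN⟩ := exists_nat_ge (-a)
  have hN0 : 0 ≤ a + N := by linarith
  let u : ℕ → ℕ := fun k => (rawc (g k)).unpair.1
  let d : ℕ → ℕ := fun k => (rawc (g k)).unpair.2
  have hu : Computable u :=
    Computable.fst.comp (Primrec.unpair.to_comp.comp (computable_rawc.comp hg))
  have hd : Computable d :=
    Computable.snd.comp (Primrec.unpair.to_comp.comp (computable_rawc.comp hg))
  let P : ℕ × ℕ → ℕ := fun x =>
    (N * x.2 + (x.1 % 2) * ((x.1 + 1) / 2)) - (1 - x.1 % 2) * (x.1 / 2)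
  have hP : Primrec P := by
    have m2 : Primrec fun x : ℕ × ℕ => x.1 % 2 :=
      Primrec.nat_mod.comp Primrec.fst (Primrec.const 2)
    exact Primrec.nat_sub.comp
      (Primrec.nat_add.comp (Primrec.nat_mul.comp (Primrec.const N) Primrec.snd)
        (Primrec.nat_mul.comp m2
          (Primrec.nat_div.comp (Primrec.succ.comp Primrec.fst) (Primrec.const 2))))
      (Primrec.nat_mul.comp (Primrec.nat_sub.comp (Primrec.const 1) m2)
        (Primrec.nat_div.comp Primrec.fst (Primrec.const 2)))
  have hPz : ∀ (z : ℤ) (e : ℕ), P (intc z, e) = (N * e - z).toNat := by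
    intro z e
    have h0 : ((N * e : ℕ) : ℤ) = N * e := by push_cast; rfl
    rw [← h0]
    generalize hM : N * e = M
    cases z with
    | ofNat n =>
      have h1 : 2 * n % 2 = 0 := by omega
      have h2 : 2 * n / 2 = n := by omega
      simp only [P, intc, hM, h1, h2]
      simp
    | negSucc n =>
      have h1 : (2 * n + 1) % 2 = 1 := by omega
      have h2 : (2 * n + 1 + 1) / 2 = n + 1 := by omega
      simp only [P, intc, hM, h1, h2]
      simp only [Int.negSucc_eq]
      omega
  have hud : ∀ k, u k = intc (g k).num ∧ d k = (g k).den := by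
    intro k
    simp [u, d, rawc_eq]
  have hval : ∀ k, ((P (u k, d k) : ℕ) : ℝ) / (d k : ℝ) = max (N - (g k : ℝ)) 0 := by
    intro k
    have hden : (0 : ℝ) < (g k).den := by exact_mod_cast (g k).pos
    rw [(hud k).1, (hud k).2, hPz]
    have h1 : (((N * (g k).den - (g k).num : ℤ).toNat : ℕ) : ℝ) =
        max ((N : ℝ) * (g k).den - (g k).num) 0 := by
      have := Int.toNat_eq_max (N * (g k).den - (g k).num : ℤ)
      have h2 : ((((N * (g k).den - (g k).num : ℤ).toNat : ℕ) : ℤ) : ℝ) =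
        ((max (N * (g k).den - (g k).num : ℤ) 0 : ℤ) : ℝ) := by rw [this]
      push_cast at h2
      exact_mod_cast h2
    have h3 : (g k : ℝ) = (g k).num / (g k).den := by exact_mod_cast (Rat.num_div_den (g k)).symm
    rw [h1, h3, ← max_div_div_right hden.le, zero_div, sub_div, mul_div_cancel_right₀ _ hden.ne']
  refine ⟨N, fun k => P (u k, d k), d, hP.to_comp.comp (hu.pair hd), hd, hN0, ?_, ?_, ?_⟩
  · intro k
    rw [(hud k).2]
    exact (g k).pos
  · intro k
    rw [hval]
    have := hle k
    exact max_le (by linarith) hN0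
  · simp only [hval]
    have h := (hlim.const_sub (N : ℝ)).max (tendsto_const_nhds (x := (0 : ℝ)))
    have e : max ((N : ℝ) - -a) 0 = a + N := by
      rw [max_eq_left (by linarith)]; ring
    rwa [e] at h

/-! ### Binary prefixes -/

theorem binPrefix_add_nat (T : ℝ) (N n : ℕ) : binPrefix (T + N) n = binPrefix T n := by
  simp [binPrefix]

theorem binPrefix_eq {T : ℝ} (hT : 0 ≤ T) (n : ℕ) :
    binPrefix T n = (List.range n).map (fun i => decide (⌊T * 2 ^ (i + 1)⌋₊ % 2 = 1)) := by
  unfold binPrefix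
  refine List.map_congr_left fun i _ => ?_
  have h1 : Int.fract T * 2 ^ (i + 1) = T * 2 ^ (i + 1) - ((⌊T⌋ * 2 ^ (i + 1) : ℤ) : ℝ) := by
    rw [Int.fract]; push_cast; ring
  have h2 : ((⌊T * 2 ^ (i + 1)⌋₊ : ℕ) : ℤ) = ⌊T * 2 ^ (i + 1)⌋ :=
    Int.natCast_floor_eq_floor (by positivity)
  have h3 : ⌊T⌋ * 2 ^ (i + 1) = 2 * (⌊T⌋ * 2 ^ i) := by ring
  rw [h1, Int.floor_sub_intCast, ← h2, h3]
  refine decide_eq_decide.2 ?_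
  omega

/-- Value of a bit string with a given integer part. -/
def val (M : ℕ) (s : Str) : ℕ := s.foldl (fun acc b => 2 * acc + b.toNat) M

theorem floor_double (x : ℝ) : ⌊x * 2⌋₊ = 2 * ⌊x⌋₊ + ⌊x * 2⌋₊ % 2 := by
  have : ⌊x⌋₊ = ⌊x * 2⌋₊ / 2 := by
    have := Nat.floor_div_natCast (x * 2) 2
    rw [← this]
    congr 1
    push_cast
    ring
  omega

theorem val_binPrefix {T : ℝ} (hT : 0 ≤ T) (n : ℕ) :
    val ⌊T⌋₊ (binPrefix T n) = ⌊T * 2 ^ n⌋₊ := by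
  rw [binPrefix_eq hT]
  induction n with
  | zero => simp [val]
  | succ n ih =>
    rw [List.range_succ, List.map_append, val, List.foldl_append]
    unfold val at ih
    rw [ih, pow_succ, ← mul_assoc, floor_double (T * 2 ^ n)]
    simp only [List.map_cons, List.map_nil, List.foldl_cons, List.foldl_nil]
    rw [pow_succ, ← mul_assoc]
    rcases Nat.mod_two_eq_zero_or_one ⌊T * 2 ^ n * 2⌋₊ with h | h <;> simp [h]

theorem length_binPrefix (T : ℝ) (n : ℕ) : (binPrefix T n).length = n := by
  simp [binPrefix]

/-- The last `n` binary digits of `m`. -/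
def bits (n m : ℕ) : Str :=
  (List.range n).map fun j => decide (m / 2 ^ (n - 1 - j) % 2 = 1)

theorem bits_floor {T : ℝ} (hT : 0 ≤ T) (n : ℕ) : bits n ⌊T * 2 ^ n⌋₊ = binPrefix T n := by
  rw [binPrefix_eq hT]
  refine List.map_congr_left fun j hj => ?_
  rw [List.mem_range] at hj
  have h := Nat.floor_div_natCast (T * 2 ^ n) (2 ^ (n - 1 - j))
  rw [← h]
  have e : T * 2 ^ n / ((2 ^ (n - 1 - j) : ℕ) : ℝ) = T * 2 ^ (j + 1) := by
    push_cast
    rw [div_eq_iff (by positivity), mul_assoc, ← pow_add]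
    congr 2
    omega
  rw [e]

theorem primrec_pow2 : Primrec fun n : ℕ => 2 ^ n := by
  have h : Primrec₂ (fun a b : ℕ => a ^ b) := Primrec₂.unpaired'.1 Nat.Primrec.pow
  exact h.comp (Primrec.const 2) Primrec.id

theorem primrec_val (M : ℕ) : Primrec (val M) := by
  have h : Primrec₂ fun (_ : Str) (x : ℕ × Bool) => 2 * x.1 + x.2.toNat :=
    (Primrec.nat_add.comp (Primrec.nat_double.comp (Primrec.fst.comp Primrec.snd))
      ((Primrec.dom_bool Bool.toNat).comp (Primrec.snd.comp Primrec.snd))).to₂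
  exact Primrec.list_foldl Primrec.id (Primrec.const M) h

theorem primrec_bits : Primrec₂ bits := by
  have h : Primrec₂ fun (x : ℕ × ℕ) (j : ℕ) => decide (x.2 / 2 ^ (x.1 - 1 - j) % 2 = 1) := by
    have h1 : Primrec fun y : (ℕ × ℕ) × ℕ => y.1.1 - 1 - y.2 :=
      Primrec.nat_sub.comp (Primrec.nat_sub.comp (Primrec.fst.comp Primrec.fst)
        (Primrec.const 1)) Primrec.snd
    have h2 : Primrec fun y : (ℕ × ℕ) × ℕ => y.1.2 / 2 ^ (y.1.1 - 1 - y.2) % 2 :=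
      Primrec.nat_mod.comp (Primrec.nat_div.comp
        (Primrec.snd.comp Primrec.fst) (primrec_pow2.comp h1)) (Primrec.const 2)
    have h3 : Primrec₂ fun u v : ℕ => decide (u = v) := Primrec.eq.decide
    exact (h3.comp h2 (Primrec.const 1)).to₂
  exact (Primrec.list_map (Primrec.list_range.comp Primrec.fst) h).to₂

/-! ### The search -/

section Search

variable (p q pb qb : ℕ → ℕ) (M i : ℕ)

/-- Stage `k` approximates the number coded by `s` well enough. -/
def stageOk (s : Str) (k : ℕ) : Bool :=
  decide (val M s * (q k * qb k) <
    2 ^ s.length * (p k * qb k + pb k * q k) + q k * qb k)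

/-- The output at stage `k`. -/
def out (s : Str) (k : ℕ) : Str := bits s.length (2 ^ s.length * p k / q k + i)

/-- The partial recursive map guessing the prefix of `a` from the prefix of `a + b`. -/
def guess (s : Str) : Part Str :=
  (Nat.rfind fun k => Part.some (stageOk p q pb qb M s k)).map (out p q i s)

variable {p q pb qb}

theorem partrec_guess (hp : Computable p) (hq : Computable q) (hp' : Computable pb)
    (hq' : Computable qb) : Partrec (guess p q pb qb M i) := by
  have hk : ∀ {f : ℕ → ℕ}, Computable f → Computable fun x : Str × ℕ => f x.2 :=
    fun hf => hf.comp Computable.snd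
  have hpow : Computable fun x : Str × ℕ => 2 ^ x.1.length :=
    (primrec_pow2.comp (Primrec.list_length.comp Primrec.fst)).to_comp
  have mul := Primrec.nat_mul.to_comp
  have hadd := Primrec.nat_add.to_comp
  have hqq := mul.comp (hk hq) (hk hq')
  have ht : Computable₂ (stageOk p q pb qb M) := by
    have hlt : Computable₂ fun u v : ℕ => decide (u < v) := Primrec.nat_lt.decide.to_comp
    exact hlt.comp
      (mul.comp ((primrec_val M).to_comp.comp Computable.fst) hqq)
      (hadd.comp (mul.comp hpow (hadd.comp (mul.comp (hk hp) (hk hq'))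
        (mul.comp (hk hp') (hk hq)))) hqq)
  have ho : Computable₂ (out p q i) := by
    exact primrec_bits.to_comp.comp (Computable.list_length.comp Computable.fst)
      (hadd.comp (Primrec.nat_div.to_comp.comp (mul.comp hpow (hk hp)) (hk hq))
        (Computable.const i))
  have hr : Partrec fun s => Nat.rfind fun k => (Part.some (stageOk p q pb qb M s k) : Part Bool) :=
    Partrec.rfind (p := fun s k => (Part.some (stageOk p q pb qb M s k) : Part Bool)) ht
  exact hr.map ho

end Search

theorem exists_guess {a b : ℝ} (ha : 0 ≤ a) (hb : 0 ≤ b) {p q pb qb : ℕ → ℕ}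
    (hq : ∀ k, 0 < q k) (hq' : ∀ k, 0 < qb k)
    (hpa : ∀ k, (p k : ℝ) / q k ≤ a) (hpb : ∀ k, (pb k : ℝ) / qb k ≤ b)
    (hla : Tendsto (fun k => (p k : ℝ) / q k) atTop (𝓝 a))
    (hlb : Tendsto (fun k => (pb k : ℝ) / qb k) atTop (𝓝 b)) (n : ℕ) :
    ∃ i < 3, binPrefix a n ∈ guess p q pb qb ⌊a + b⌋₊ i (binPrefix (a + b) n) := by
  have hab : 0 ≤ a + b := add_nonneg ha hb
  have h2n : (0 : ℝ) < 2 ^ n := by positivity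
  set s := binPrefix (a + b) n with hs
  have hlen : s.length = n := length_binPrefix _ _
  have hv : val ⌊a + b⌋₊ s = ⌊(a + b) * 2 ^ n⌋₊ := val_binPrefix hab n
  have htest : ∀ k, stageOk p q pb qb ⌊a + b⌋₊ s k = true ↔
      (⌊(a + b) * 2 ^ n⌋₊ : ℝ) < 2 ^ n * ((p k : ℝ) / q k + (pb k : ℝ) / qb k) + 1 := by
    intro k
    have h1 : (0 : ℝ) < q k := by exact_mod_cast hq k
    have h2 : (0 : ℝ) < qb k := by exact_mod_cast hq' k
    rw [stageOk, decide_eq_true_iff, hv, hlen]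
    generalize ⌊(a + b) * 2 ^ n⌋₊ = v
    rw [← Nat.cast_lt (α := ℝ)]
    push_cast
    have e : (2 : ℝ) ^ n * (p k * qb k + pb k * q k) + q k * qb k =
        (2 ^ n * ((p k : ℝ) / q k + (pb k : ℝ) / qb k) + 1) * (q k * qb k) := by
      field_simp
    rw [e]
    exact mul_lt_mul_iff_left₀ (mul_pos h1 h2)
  have hfl : (⌊(a + b) * 2 ^ n⌋₊ : ℝ) ≤ (a + b) * 2 ^ n := Nat.floor_le (by positivity)
  have hex : ∃ k, stageOk p q pb qb ⌊a + b⌋₊ s k = true := by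
    have hl : Tendsto (fun k => 2 ^ n * ((p k : ℝ) / q k + (pb k : ℝ) / qb k) + 1) atTop
        (𝓝 (2 ^ n * (a + b) + 1)) := ((hla.add hlb).const_mul _).add_const _
    have hlt : (⌊(a + b) * 2 ^ n⌋₊ : ℝ) < 2 ^ n * (a + b) + 1 := by linarith
    obtain ⟨k, hk⟩ := (hl.eventually_const_lt hlt).exists
    exact ⟨k, (htest k).2 hk⟩
  obtain ⟨k0, hk0⟩ := hex
  obtain ⟨k, hk, -⟩ := Nat.rfind_min' (p := stageOk p q pb qb ⌊a + b⌋₊ s) hk0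
  have hkt : stageOk p q pb qb ⌊a + b⌋₊ s k = true := by
    obtain ⟨_, h⟩ := Nat.rfind_spec hk
    exact h
  rw [htest] at hkt
  have hfl2 := Nat.lt_floor_add_one ((a + b) * 2 ^ n)
  have hdiv : 2 ^ n * p k / q k = ⌊(2 : ℝ) ^ n * ((p k : ℝ) / q k)⌋₊ := by
    rw [← Nat.floor_div_eq_div (K := ℝ)]
    push_cast
    rw [mul_div_assoc]
  have hup : a * 2 ^ n < 2 ^ n * ((p k : ℝ) / q k) + 2 := by
    have := mul_le_mul_of_nonneg_left (hpb k) h2n.le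
    linarith
  have hlo : 2 ^ n * ((p k : ℝ) / q k) ≤ a * 2 ^ n := by
    have := mul_le_mul_of_nonneg_left (hpa k) h2n.le
    linarith
  have hm1 : 2 ^ n * p k / q k ≤ ⌊a * 2 ^ n⌋₊ := by
    rw [hdiv]; exact Nat.floor_le_floor hlo
  have hm2 : ⌊a * 2 ^ n⌋₊ < 2 ^ n * p k / q k + 3 := by
    rw [hdiv, Nat.floor_lt (by positivity)]
    push_cast
    have := Nat.lt_floor_add_one ((2 : ℝ) ^ n * ((p k : ℝ) / q k))
    linarith
  refine ⟨⌊a * 2 ^ n⌋₊ - 2 ^ n * p k / q k, by omega, ?_⟩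
  refine (Part.mem_map_iff _).2 ⟨k, hk, ?_⟩
  rw [out, hlen, Nat.add_sub_cancel' hm1, bits_floor ha]

/-- For left-computable reals `a` and `b`, `K(a_n) ≤ K((a+b)_n) + O(1)`. -/
theorem K_prefix_le_of_add_left_computable (U : OptimalComputer) (a b : ℝ)
    (ha : LeftComputableReal a) (hb : LeftComputableReal b) :
    ∃ c : ℕ, ∀ n : ℕ, 0 < n →
      Kc U (binPrefix a n) ≤ Kc U (binPrefix (a + b) n) + c := by
  obtain ⟨N, p, q, hp, hq, hN, hq0, hle, hlim⟩ := exists_nat_approx ha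
  obtain ⟨Nb, pb, qb, hp', hq', hN', hq0', hle', hlim'⟩ := exists_nat_approx hb
  have hc := fun i => Kc_le_of_partrec U _
    (partrec_guess ⌊(a + N) + (b + Nb)⌋₊ i hp hq hp' hq')
  choose c hc using hc
  refine ⟨c 0 + c 1 + c 2, fun n _ => ?_⟩
  obtain ⟨i, hi, hg⟩ := exists_guess hN hN' hq0 hq0' hle hle' hlim hlim' n
  have h := hc i _ _ hg
  have e : (a + N) + (b + Nb) = (a + b) + ((N + Nb : ℕ) : ℝ) := by push_cast; ring
  rw [e, binPrefix_add_nat, binPrefix_add_nat] at h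
  interval_cases i <;> omega

end Paper
end

section
/- Let m be a universal probability and q a computable real with q > 1. If m(s) ≤ q^{1/(1-q)} for all s ∈ {0,1}*, then the Tsallis entropy S_q(m) = (1/(q-1)) ∑_s (m(s) - m(s)^q) is a left-computable real number that is weakly Chaitin random. -/
open Filter Topology

namespace Paper

section Coding

theorem comp_find {α : Type*} [Primcodable α] (P : α → ℕ → Bool) (hP : Computable₂ P)
    (h : ∀ a, ∃ n, P a n = true) : Computable (fun a => Nat.find (h a)) := by
  have h1 : Partrec (fun a => Nat.rfind (fun n => (Part.some (P a n) : Part Bool))) :=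
    Partrec.rfind (p := fun a n => Part.some (P a n)) hP
  refine h1.of_eq_tot fun a => ?_
  refine Nat.mem_rfind.2 ?_
  refine ⟨by simpa using (Nat.find_spec (h a)).symm, fun {m} hm => ?_⟩
  have := Nat.find_min (h a) hm
  simpa using this

theorem cpadd {α : Type*} [Primcodable α] {f g : α → ℕ} (hf : Computable f) (hg : Computable g) :
    Computable (fun a => f a + g a) := Primrec.nat_add.to_comp.comp hf hg
theorem cpmul {α : Type*} [Primcodable α] {f g : α → ℕ} (hf : Computable f) (hg : Computable g) :
    Computable (fun a => f a * g a) := Primrec.nat_mul.to_comp.comp hf hg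
theorem cpdiv {α : Type*} [Primcodable α] {f g : α → ℕ} (hf : Computable f) (hg : Computable g) :
    Computable (fun a => f a / g a) := Primrec.nat_div.to_comp.comp hf hg
theorem cpmod {α : Type*} [Primcodable α] {f g : α → ℕ} (hf : Computable f) (hg : Computable g) :
    Computable (fun a => f a % g a) := Primrec.nat_mod.to_comp.comp hf hg
theorem cple {α : Type*} [Primcodable α] {f g : α → ℕ} (hf : Computable f) (hg : Computable g) :
    Computable (fun a => decide (f a ≤ g a)) :=
  (Primrec.nat_le.decide.to_comp).comp hf hg
theorem cpeq {α : Type*} [Primcodable α] {f g : α → ℕ} (hf : Computable f) (hg : Computable g) :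
    Computable (fun a => decide (f a = g a)) :=
  ((Primrec.eq (α := ℕ)).decide.to_comp).comp hf hg
theorem cpite {α β : Type*} [Primcodable α] [Primcodable β] {P : α → Prop} [DecidablePred P]
    {f g : α → β}
    (hP : Computable (fun a => decide (P a))) (hf : Computable f) (hg : Computable g) :
    Computable (fun a => if P a then f a else g a) :=
  (Computable.cond hP hf hg).of_eq fun a => by by_cases h : P a <;> simp [h]
theorem cpand {α : Type*} [Primcodable α] {P Q : α → Prop} [DecidablePred P] [DecidablePred Q]
    (hP : Computable (fun a => decide (P a))) (hQ : Computable (fun a => decide (Q a))) :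
    Computable (fun a => decide (P a ∧ Q a)) :=
  (Primrec.and.to_comp.comp hP hQ).of_eq fun a => by simp

/-- auxiliary (non-canonical) code of a rational. -/
def ec (q : ℚ) : ℕ := @Encodable.encode ℚ Rat.instEncodable q

def Sc : Set ℕ := Set.range ec

theorem ec_eq (q : ℚ) : ec q = Nat.pair (@Encodable.encode ℤ inferInstance q.num) q.den := rfl

theorem encZ_pos (a : ℕ) : @Encodable.encode ℤ inferInstance (Int.ofNat a) = 2*a := rfl
theorem encZ_neg (a : ℕ) : @Encodable.encode ℤ inferInstance (Int.negSucc a) = 2*a+1 := rfl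

theorem mem_Sc (x : ℕ) : x ∈ Sc ↔ (0 < x.unpair.2 ∧ ∀ k < x.unpair.2 + 1,
    ¬ (1 < k ∧ ((x.unpair.1 + 1) / 2) % k = 0 ∧ x.unpair.2 % k = 0)) := by
  have key : ∀ n d : ℕ, 0 < d → (Nat.Coprime n d ↔ ∀ k < d + 1, ¬ (1 < k ∧ n % k = 0 ∧ d % k = 0)) := by
    intro n d hd
    constructor
    · rintro h k - ⟨h1, h2, h3⟩
      have := Nat.dvd_gcd (Nat.dvd_of_mod_eq_zero h2) (Nat.dvd_of_mod_eq_zero h3)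
      rw [h] at this
      have := Nat.le_of_dvd one_pos this
      omega
    · intro h
      by_contra hc
      have hg : Nat.gcd n d ≠ 1 := hc
      have h0 : 0 < Nat.gcd n d := Nat.gcd_pos_of_pos_right _ hd
      refine h (Nat.gcd n d) ?_ ⟨by omega, ?_, ?_⟩
      · exact Nat.lt_succ_of_le (Nat.le_of_dvd hd (Nat.gcd_dvd_right _ _))
      · exact Nat.mod_eq_zero_of_dvd (Nat.gcd_dvd_left _ _)
      · exact Nat.mod_eq_zero_of_dvd (Nat.gcd_dvd_right _ _)
  constructor
  · rintro ⟨q, rfl⟩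
    rw [ec_eq, Nat.unpair_pair]
    refine ⟨q.den_pos, ?_⟩
    refine (key _ _ q.den_pos).1 ?_
    have h := q.reduced
    rcases hq : q.num with a | a
    · rw [encZ_pos]; rw [hq] at h
      simpa [show (2 * a + 1) / 2 = a by omega] using h
    · rw [encZ_neg]; rw [hq] at h
      simpa [show (2 * a + 1 + 1) / 2 = a + 1 by omega] using h
  · rintro ⟨hd, h⟩
    have h := (key _ _ hd).2 h
    rcases Nat.even_or_odd' x.unpair.1 with ⟨a, ha | ha⟩
    · refine ⟨⟨Int.ofNat a, x.unpair.2, hd.ne', ?_⟩, ?_⟩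
      · rw [ha] at h
        simpa [show (2 * a + 1) / 2 = a by omega] using h
      · rw [ec_eq]; show Nat.pair (@Encodable.encode ℤ inferInstance (Int.ofNat a)) _ = _
        exact (congrArg (fun t => Nat.pair t x.unpair.2) ha.symm).trans (Nat.pair_unpair x)
    · refine ⟨⟨Int.negSucc a, x.unpair.2, hd.ne', ?_⟩, ?_⟩
      · rw [ha] at h
        simpa [show (2 * a + 1 + 1) / 2 = a + 1 by omega] using h
      · rw [ec_eq]; show Nat.pair (@Encodable.encode ℤ inferInstance (Int.negSucc a)) _ = _
        exact (congrArg (fun t => Nat.pair t x.unpair.2) ha.symm).trans (Nat.pair_unpair x)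

theorem primrec_Sc : PrimrecPred (fun x => x ∈ Sc) := by
  have h1 : PrimrecRel (fun (k : ℕ) (x : ℕ) =>
      ¬ (1 < k ∧ ((x.unpair.1 + 1) / 2) % k = 0 ∧ x.unpair.2 % k = 0)) := by
    refine PrimrecPred.not ?_
    refine PrimrecPred.and (Primrec.nat_lt.comp (Primrec.const 1) Primrec.fst)
      (PrimrecPred.and (Primrec.eq.comp (Primrec.nat_mod.comp (Primrec.nat_div.comp
        (Primrec.succ.comp (Primrec.fst.comp (Primrec.unpair.comp Primrec.snd))) (Primrec.const 2)) Primrec.fst)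
        (Primrec.const 0)) (Primrec.eq.comp (Primrec.nat_mod.comp
        (Primrec.snd.comp (Primrec.unpair.comp Primrec.snd)) Primrec.fst) (Primrec.const 0)))
  have h2 := h1.forall_lt
  have h3 : PrimrecPred (fun x : ℕ => 0 < x.unpair.2) :=
    Primrec.nat_lt.comp (Primrec.const 0) (Primrec.snd.comp Primrec.unpair)
  exact (h3.and (h2.comp (Primrec.succ.comp (Primrec.snd.comp Primrec.unpair)) Primrec.id)).of_eq
    fun x => (mem_Sc x).symm

theorem infSc : Infinite Sc :=
    Infinite.of_injective _ (Equiv.ofInjective _ (@Encodable.encode_injective ℚ Rat.instEncodable)).injective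

theorem rc_eq (n : ℕ) : ec (Denumerable.ofNat ℚ n) =
    (@Nat.Subtype.ofNat Sc (@Encodable.decidableRangeEncode ℚ Rat.instEncodable) infSc n).val := by
  show (@Encodable.encode ℚ Rat.instEncodable ((@Encodable.equivRangeEncode ℚ Rat.instEncodable).symm (@Nat.Subtype.ofNat (Set.range (@Encodable.encode ℚ Rat.instEncodable)) (@Encodable.decidableRangeEncode ℚ Rat.instEncodable) infSc n))) = _
  change _ = (@Nat.Subtype.ofNat (Set.range (@Encodable.encode ℚ Rat.instEncodable)) (@Encodable.decidableRangeEncode ℚ Rat.instEncodable) infSc n).val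
  generalize (@Nat.Subtype.ofNat (Set.range (@Encodable.encode ℚ Rat.instEncodable)) (@Encodable.decidableRangeEncode ℚ Rat.instEncodable) infSc n) = x
  obtain ⟨q, rfl⟩ := (@Encodable.equivRangeEncode ℚ Rat.instEncodable).surjective x
  simp [Encodable.equivRangeEncode]

theorem succ_val (s : Set ℕ) (hs : Infinite s) (_inst : DecidablePred (· ∈ s))
    (inst' : DecidablePred (· ∈ s)) (x : s)
    (h : ∃ m, @decide (x.val + m + 1 ∈ s) (inst' _) = true) :
    (@Nat.Subtype.succ s hs _inst x).val = x.val + Nat.find h + 1 := by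
  obtain rfl : _inst = inst' := Subsingleton.elim _ _
  simp only [Nat.Subtype.succ]
  congr 2
  refine le_antisymm ?_ ?_
  · refine Nat.find_min' _ ?_
    simpa using Nat.find_spec h
  · refine Nat.find_min' _ ?_
    rw [decide_eq_true_eq]
    exact Nat.find_spec (Nat.Subtype.exists_succ x)

theorem comp_rc : Computable (fun n : ℕ => ec (Denumerable.ofNat ℚ n)) := by
  classical
  have hex : ∀ x : ℕ, ∃ m, decide (x + m + 1 ∈ Sc) = true := by
    intro x
    have hS : Sc.Infinite := Set.infinite_coe_iff.1 infSc
    obtain ⟨y, hy, hxy⟩ := hS.exists_gt x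
    exact ⟨y - x - 1, by simpa [show x + (y - x - 1) + 1 = y by omega] using hy⟩
  have hc : Computable (fun x => Nat.find (hex x)) := by
    refine comp_find (fun x m => decide (x + m + 1 ∈ Sc)) ?_ hex
    exact (primrec_Sc.decide.to_comp).comp
      (Computable.succ.comp (cpadd Computable.fst Computable.snd))
  have h := Computable.nat_rec (f := fun n : ℕ => n) (g := fun _ => ec (Denumerable.ofNat ℚ 0))
    (h := fun _ p => p.2 + Nat.find (hex p.2) + 1) Computable.id (Computable.const _)
    (Computable.succ.comp (cpadd (Computable.snd.comp Computable.snd)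
      (hc.comp (Computable.snd.comp Computable.snd))))
  refine h.of_eq fun n => ?_
  induction n with
  | zero => rfl
  | succ n ih =>
    simp only at ih ⊢
    rw [ih, rc_eq, rc_eq]
    have h2 : (@Nat.Subtype.ofNat Sc (@Encodable.decidableRangeEncode ℚ Rat.instEncodable) infSc (n+1))
      = @Nat.Subtype.succ Sc infSc (@Encodable.decidableRangeEncode ℚ Rat.instEncodable) (@Nat.Subtype.ofNat Sc (@Encodable.decidableRangeEncode ℚ Rat.instEncodable) infSc n) := rfl
    rw [h2]
    exact (succ_val Sc infSc _ (fun _ => Classical.propDecidable _) (@Nat.Subtype.ofNat Sc (@Encodable.decidableRangeEncode ℚ Rat.instEncodable) infSc n) (hex _)).symm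

theorem comp_ec : Computable ec :=
  (comp_rc.comp Computable.encode).of_eq fun q => congrArg ec (Denumerable.ofNat_encode q)

theorem comp_den : Computable (fun q : ℚ => q.den) :=
  (Computable.snd.comp (Computable.unpair.comp comp_ec)).of_eq fun q => by simp [ec_eq]

def qp (q : ℚ) : ℕ := q.num.toNat
def qn (q : ℚ) : ℕ := (-q.num).toNat

theorem comp_qp : Computable qp := by
  have h1 : Computable (fun q => (ec q).unpair.1) := Computable.fst.comp (Computable.unpair.comp comp_ec)
  refine (cpite (cpeq (cpmod h1 (Computable.const 2)) (Computable.const 0))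
    (cpdiv h1 (Computable.const 2)) (Computable.const 0)).of_eq fun q => ?_
  rw [ec_eq, Nat.unpair_pair, qp]
  rcases hq : q.num with a | a
  · rw [encZ_pos]; simp
  · rw [encZ_neg]; simp

theorem comp_qn : Computable qn := by
  have h1 : Computable (fun q => (ec q).unpair.1) := Computable.fst.comp (Computable.unpair.comp comp_ec)
  refine (cpite (cpeq (cpmod h1 (Computable.const 2)) (Computable.const 0))
    (Computable.const 0) (cpdiv (Computable.succ.comp h1) (Computable.const 2))).of_eq fun q => ?_
  rw [ec_eq, Nat.unpair_pair, qn]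
  rcases hq : q.num with a | a
  · rw [encZ_pos]; simp
  · rw [encZ_neg]; simp; omega

theorem q_eq (q : ℚ) : q = ((qp q : ℚ) - qn q) / q.den := by
  have h : ((qp q : ℤ) - qn q) = q.num := by simp only [qp, qn]; omega
  have h2 : ((qp q : ℚ) - qn q) = q.num := by exact_mod_cast congrArg (Int.cast (R := ℚ)) h
  rw [h2, Rat.num_div_den]

theorem comp_graph {α : Type*} [Primcodable α] {h : α → ℚ} (B : α → ℚ → Prop)
    [∀ a, DecidablePred (B a)]
    (hB : Computable (fun p : α × ℚ => decide (B p.1 p.2))) (hh : ∀ a r, B a r ↔ h a = r) :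
    Computable h := by
  rw [← Computable.encode_iff]
  have hex : ∀ a, ∃ n, decide (B a (Denumerable.ofNat ℚ n)) = true := fun a =>
    ⟨@Encodable.encode ℚ Primcodable.toEncodable (h a), by
      rw [decide_eq_true_eq, hh]; exact (Denumerable.ofNat_encode (h a)).symm⟩
  refine (comp_find (fun a n => decide (B a (Denumerable.ofNat ℚ n)))
    (hB.comp (Computable.pair Computable.fst ((Primrec.ofNat ℚ).to_comp.comp Computable.snd))) hex).of_eq
    fun a => ?_
  have := Nat.find_spec (hex a)
  rw [decide_eq_true_eq, hh] at this
  generalize Nat.find (hex a) = k at this ⊢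
  rw [this]
  exact (@Denumerable.encode_ofNat ℚ Rat.instDenumerable k).symm

theorem cqadd {α : Type*} [Primcodable α] {f g : α → ℚ} (hf : Computable f) (hg : Computable g) :
    Computable (fun a => f a + g a) := by
  have hF : Computable (fun p : α × ℚ => f p.1) := hf.comp Computable.fst
  have hG : Computable (fun p : α × ℚ => g p.1) := hg.comp Computable.fst
  have hR : Computable (fun p : α × ℚ => p.2) := Computable.snd
  refine comp_graph (fun a r => qp (f a) * (g a).den * r.den + qp (g a) * (f a).den * r.den
      + qn r * (f a).den * (g a).den = qn (f a) * (g a).den * r.den + qn (g a) * (f a).den * r.den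
      + qp r * (f a).den * (g a).den) ?_ ?_
  · exact cpeq (cpadd (cpadd (cpmul (cpmul (comp_qp.comp hF) (comp_den.comp hG)) (comp_den.comp hR))
      (cpmul (cpmul (comp_qp.comp hG) (comp_den.comp hF)) (comp_den.comp hR)))
      (cpmul (cpmul (comp_qn.comp hR) (comp_den.comp hF)) (comp_den.comp hG)))
      (cpadd (cpadd (cpmul (cpmul (comp_qn.comp hF) (comp_den.comp hG)) (comp_den.comp hR))
      (cpmul (cpmul (comp_qn.comp hG) (comp_den.comp hF)) (comp_den.comp hR)))
      (cpmul (cpmul (comp_qp.comp hR) (comp_den.comp hF)) (comp_den.comp hG)))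
  · intro a r
    have h1 := q_eq (f a); have h2 := q_eq (g a); have h3 := q_eq r
    have d1 : ((f a).den : ℚ) ≠ 0 := by exact_mod_cast (f a).den_nz
    have d2 : ((g a).den : ℚ) ≠ 0 := by exact_mod_cast (g a).den_nz
    have d3 : (r.den : ℚ) ≠ 0 := by exact_mod_cast r.den_nz
    rw [← Nat.cast_inj (R := ℚ)]
    conv_rhs => rw [h1, h2, h3]
    push_cast
    rw [div_add_div _ _ d1 d2, div_eq_div_iff (mul_ne_zero d1 d2) d3]
    constructor <;> intro h <;> linear_combination h

theorem cqmul {α : Type*} [Primcodable α] {f g : α → ℚ} (hf : Computable f) (hg : Computable g) :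
    Computable (fun a => f a * g a) := by
  have hF : Computable (fun p : α × ℚ => f p.1) := hf.comp Computable.fst
  have hG : Computable (fun p : α × ℚ => g p.1) := hg.comp Computable.fst
  have hR : Computable (fun p : α × ℚ => p.2) := Computable.snd
  refine comp_graph (fun a r => qp (f a) * qp (g a) * r.den + qn (f a) * qn (g a) * r.den
      + qn r * (f a).den * (g a).den = qn (f a) * qp (g a) * r.den + qp (f a) * qn (g a) * r.den
      + qp r * (f a).den * (g a).den) ?_ ?_
  · exact cpeq (cpadd (cpadd (cpmul (cpmul (comp_qp.comp hF) (comp_qp.comp hG)) (comp_den.comp hR))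
      (cpmul (cpmul (comp_qn.comp hF) (comp_qn.comp hG)) (comp_den.comp hR)))
      (cpmul (cpmul (comp_qn.comp hR) (comp_den.comp hF)) (comp_den.comp hG)))
      (cpadd (cpadd (cpmul (cpmul (comp_qn.comp hF) (comp_qp.comp hG)) (comp_den.comp hR))
      (cpmul (cpmul (comp_qp.comp hF) (comp_qn.comp hG)) (comp_den.comp hR)))
      (cpmul (cpmul (comp_qp.comp hR) (comp_den.comp hF)) (comp_den.comp hG)))
  · intro a r
    have h1 := q_eq (f a); have h2 := q_eq (g a); have h3 := q_eq r
    have d1 : ((f a).den : ℚ) ≠ 0 := by exact_mod_cast (f a).den_nz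
    have d2 : ((g a).den : ℚ) ≠ 0 := by exact_mod_cast (g a).den_nz
    have d3 : (r.den : ℚ) ≠ 0 := by exact_mod_cast r.den_nz
    rw [← Nat.cast_inj (R := ℚ)]
    conv_rhs => rw [h1, h2, h3]
    push_cast
    rw [div_mul_div_comm, div_eq_div_iff (mul_ne_zero d1 d2) d3]
    constructor <;> intro h <;> linear_combination h

theorem cqle {α : Type*} [Primcodable α] {f g : α → ℚ} (hf : Computable f) (hg : Computable g) :
    Computable (fun a => decide (f a ≤ g a)) := by
  refine (cple (cpadd (cpmul (comp_qp.comp hf) (comp_den.comp hg)) (cpmul (comp_qn.comp hg) (comp_den.comp hf)))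
    (cpadd (cpmul (comp_qp.comp hg) (comp_den.comp hf)) (cpmul (comp_qn.comp hf) (comp_den.comp hg)))).of_eq
    fun a => ?_
  have h1 := q_eq (f a); have h2 := q_eq (g a)
  have d1 : (0:ℚ) < ((f a).den : ℚ) := by exact_mod_cast (f a).den_pos
  have d2 : (0:ℚ) < ((g a).den : ℚ) := by exact_mod_cast (g a).den_pos
  rw [decide_eq_decide, ← Nat.cast_le (α := ℚ)]
  conv_rhs => rw [h1, h2]
  push_cast
  rw [div_le_div_iff₀ d1 d2]
  constructor <;> intro h <;> linarith

theorem cqeq {α : Type*} [Primcodable α] {f g : α → ℚ} (hf : Computable f) (hg : Computable g) :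
    Computable (fun a => decide (f a = g a)) :=
  (cpeq (Computable.encode.comp hf) (Computable.encode.comp hg)).of_eq fun a => by simp

theorem cqneg {α : Type*} [Primcodable α] {f : α → ℚ} (hf : Computable f) :
    Computable (fun a => - f a) :=
  (cqmul (Computable.const (-1)) hf).of_eq fun a => by ring

theorem cqsub {α : Type*} [Primcodable α] {f g : α → ℚ} (hf : Computable f) (hg : Computable g) :
    Computable (fun a => f a - g a) :=
  (cqadd hf (cqneg hg)).of_eq fun a => by ring

theorem cqinv {α : Type*} [Primcodable α] {f : α → ℚ} (hf : Computable f) :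
    Computable (fun a => (f a)⁻¹) := by
  have hF : Computable (fun p : α × ℚ => f p.1) := hf.comp Computable.fst
  have hR : Computable (fun p : α × ℚ => p.2) := Computable.snd
  refine comp_graph (fun a r => (if f a = 0 then r else f a * r) = (if f a = 0 then 0 else 1)) ?_ ?_
  · exact cqeq (cpite (cqeq hF (Computable.const 0)) hR (cqmul hF hR))
      (cpite (cqeq hF (Computable.const 0)) (Computable.const 0) (Computable.const 1))
  · intro a r
    by_cases h : f a = 0
    · simp [h, eq_comm]
    · simp only [h, if_false]
      constructor
      · intro h'; field_simp; rw [mul_comm] at h'; linarith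
      · rintro rfl; field_simp

theorem cqdiv {α : Type*} [Primcodable α] {f g : α → ℚ} (hf : Computable f) (hg : Computable g) :
    Computable (fun a => f a / g a) :=
  (cqmul hf (cqinv hg)).of_eq fun a => by rw [div_eq_mul_inv]

theorem cqpow {α : Type*} [Primcodable α] {f : α → ℚ} {n : α → ℕ} (hf : Computable f)
    (hn : Computable n) : Computable (fun a => f a ^ n a) := by
  refine (Computable.nat_rec (f := n) (g := fun _ => (1:ℚ)) (h := fun a p => p.2 * f a) hn
    (Computable.const _) (cqmul (Computable.snd.comp Computable.snd) (hf.comp Computable.fst))).of_eq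
    fun a => ?_
  induction n a with
  | zero => simp
  | succ k ih => simp only at ih ⊢; rw [ih, pow_succ]

theorem cqmax {α : Type*} [Primcodable α] {f g : α → ℚ} (hf : Computable f) (hg : Computable g) :
    Computable (fun a => max (f a) (g a)) :=
  (cpite (P := fun a => f a ≤ g a) (cqle hf hg) hg hf).of_eq fun a => by
    split_ifs with h
    · exact (max_eq_right h).symm
    · exact (max_eq_left (le_of_not_ge h)).symm

theorem cqsum {α : Type*} [Primcodable α] {f : α → ℕ → ℚ} {n : α → ℕ}
    (hf : Computable (fun p : α × ℕ => f p.1 p.2))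
    (hn : Computable n) : Computable (fun a => ∑ i ∈ Finset.range (n a), f a i) := by
  have h1 : Computable (fun p : α × (ℕ × ℚ) => f p.1 p.2.1) :=
    Computable.comp (f := fun p : α × ℕ => f p.1 p.2) (g := fun p : α × (ℕ × ℚ) => (p.1, p.2.1)) hf
      (Computable.pair Computable.fst (Computable.fst.comp Computable.snd))
  have h2 : Computable (fun p : α × (ℕ × ℚ) => p.2.2) := Computable.snd.comp Computable.snd
  have h3 : Computable₂ (fun (a : α) (p : ℕ × ℚ) => p.2 + f a p.1) := cqadd h2 h1
  refine (Computable.nat_rec hn (Computable.const (0:ℚ)) h3).of_eq fun a => ?_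
  induction n a with
  | zero => simp
  | succ k ih => simp only at ih ⊢; rw [ih, Finset.sum_range_succ]

end Coding

section LowerComp

theorem runmax {r : Str → ℝ} (h : ℕ → Str → ℚ) (hc : Computable₂ h) (h0 : ∀ s, 0 ≤ r s)
    (hle : ∀ n s, (h n s : ℝ) ≤ r s) (hsup : ∀ s, ∀ ε > 0, ∃ n, r s - ε < h n s) :
    ∃ f : ℕ → Str → ℚ, Computable₂ f ∧ (∀ s, Monotone (fun n => f n s)) ∧
      ∀ s : Str, (∀ n : ℕ, 0 ≤ f n s ∧ (f n s : ℝ) ≤ r s) ∧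
        Tendsto (fun n => (f n s : ℝ)) atTop (nhds (r s)) := by
  let f : ℕ → Str → ℚ := fun n s => Nat.rec (motive := fun _ => ℚ) 0 (fun k acc => max acc (h k s)) n
  have fs : ∀ n s, f (n+1) s = max (f n s) (h n s) := fun n s => rfl
  have hmono : ∀ s, Monotone (fun n => f n s) := fun s => monotone_nat_of_le_succ fun n => by
    simp only [fs]; exact le_max_left _ _
  have hle' : ∀ (s : Str) (n : ℕ), ((f n s : ℚ) : ℝ) ≤ r s := by
    intro s n
    induction n with
    | zero => simpa [f] using h0 s
    | succ n ih => rw [fs, Rat.cast_max]; exact max_le ih (hle n s)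
  refine ⟨f, ?_, hmono, fun s => ⟨fun n => ⟨?_, hle' s n⟩, ?_⟩⟩
  · have h1 : Computable (fun p : (ℕ × Str) × (ℕ × ℚ) => h p.2.1 p.1.2) :=
      Computable.comp (f := fun p : ℕ × Str => h p.1 p.2)
        (g := fun p : (ℕ × Str) × (ℕ × ℚ) => (p.2.1, p.1.2)) hc
        (Computable.pair (Computable.fst.comp Computable.snd) (Computable.snd.comp Computable.fst))
    have h2 : Computable (fun p : (ℕ × Str) × (ℕ × ℚ) => p.2.2) := Computable.snd.comp Computable.snd
    have h3 : Computable₂ (fun (a : ℕ × Str) (p : ℕ × ℚ) => max p.2 (h p.1 a.2)) := cqmax h2 h1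
    have h4 := Computable.nat_rec (f := fun p : ℕ × Str => p.1) Computable.fst (Computable.const (0:ℚ)) h3
    refine Computable.of_eq (g := fun p : ℕ × Str => f p.1 p.2) h4 fun p => ?_
    obtain ⟨n, s⟩ := p
    simp only
    induction n with
    | zero => simp [f]
    | succ n ih => rw [fs, ← ih]
  · have := hmono s (Nat.zero_le n)
    simpa [f] using this
  · rw [Metric.tendsto_atTop]
    intro ε hε
    obtain ⟨n, hn⟩ := hsup s ε hε
    refine ⟨n+1, fun k hk => ?_⟩
    have h1 : f (n+1) s ≤ f k s := hmono s hk
    have h2 : h n s ≤ f k s := le_trans (by rw [fs]; exact le_max_right _ _) h1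
    have h3 : (h n s : ℝ) ≤ f k s := by exact_mod_cast h2
    have h4 := hle' s k
    rw [Real.dist_eq, abs_lt]
    constructor <;> linarith

theorem pf_ud {S : Set Str} (h0 : [] ∉ S) (hS : ∀ p ∈ S, ∀ q ∈ S, p <+: q → p = q) :
    InformationTheory.UniquelyDecodable S := by
  intro L₁
  induction L₁ with
  | nil =>
    intro L₂ _ h2 he
    cases L₂ with
    | nil => rfl
    | cons a L =>
      exfalso
      have : a = [] := by
        have := he.symm
        simp at this
        exact this.1
      exact h0 (this ▸ h2 a (by simp))
  | cons a L ih =>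
    intro L₂ h1 h2 he
    cases L₂ with
    | nil =>
      exfalso
      have : a = [] := by
        simp at he
        exact he.1
      exact h0 (this ▸ h1 a (by simp))
    | cons b M =>
      have ha := h1 a (by simp)
      have hb := h2 b (by simp)
      simp only [List.flatten_cons] at he
      have hab : a = b := by
        rcases List.prefix_or_prefix_of_prefix (List.prefix_append a L.flatten)
          (he ▸ List.prefix_append b M.flatten) with h | h
        · exact hS a ha b hb h
        · exact (hS b hb a ha h).symm
      subst hab
      rw [ih M (fun w hw => h1 w (by simp [hw])) (fun w hw => h2 w (by simp [hw]))
        (List.append_cancel_left he)]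

theorem kraft (S : Finset Str) (hS : ∀ p ∈ S, ∀ q ∈ S, p <+: q → p = q) :
    ∑ p ∈ S, (1/2 : ℝ) ^ p.length ≤ 1 := by
  by_cases h0 : [] ∈ S
  · have : S = {[]} := by
      ext q
      simp only [Finset.mem_singleton]
      constructor
      · intro hq; exact (hS [] h0 q hq (List.nil_prefix)).symm
      · rintro rfl; exact h0
    rw [this]; simp
  · have := InformationTheory.kraft_mcmillan_inequality (S := S) (pf_ud (by simpa using h0) (by simpa using hS))
    simpa using this

open Classical in
/-- the "a priori" weight of the best description of `s`. -/
noncomputable def wt (D : Str →. Str) (s : Str) : ℝ :=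
  if ∃ p, s ∈ D p then (1/2 : ℝ) ^ (sInf {n | ∃ p : Str, p.length = n ∧ s ∈ D p}) else 0

theorem wt_le (D : Str →. Str) (s p : Str) (h : s ∈ D p) : (1/2 : ℝ) ^ p.length ≤ wt D s := by
  have : ∃ p, s ∈ D p := ⟨p, h⟩
  rw [wt, if_pos this]
  exact pow_le_pow_of_le_one (by norm_num) (by norm_num) (Nat.sInf_le ⟨p, rfl, h⟩)

theorem wt_att (D : Str →. Str) (s : Str) (h : ∃ p, s ∈ D p) :
    ∃ p, s ∈ D p ∧ wt D s = (1/2 : ℝ) ^ p.length := by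
  have hne : {n | ∃ p : Str, p.length = n ∧ s ∈ D p}.Nonempty := by
    obtain ⟨p, hp⟩ := h; exact ⟨_, p, rfl, hp⟩
  obtain ⟨p, hp, hs⟩ := Nat.sInf_mem hne
  exact ⟨p, hs, by rw [wt, if_pos h, hp]⟩

theorem wt_semi (D : Str →. Str) (hD : ∀ p q : Str, (D p).Dom → (D q).Dom → p <+: q → p = q) :
    SemiMeasure (wt D) := by
  classical
  have hnn : ∀ s, 0 ≤ wt D s := by
    intro s; rw [wt]; split_ifs <;> positivity
  have hsum : ∀ F : Finset Str, ∑ s ∈ F, wt D s ≤ 1 := by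
    intro F
    have hch : ∀ s, ∃ p, (∃ p, s ∈ D p) → s ∈ D p ∧ wt D s = (1/2 : ℝ) ^ p.length := by
      intro s
      by_cases h : ∃ p, s ∈ D p
      · obtain ⟨p, hp⟩ := wt_att D s h; exact ⟨p, fun _ => hp⟩
      · exact ⟨[], fun h' => absurd h' h⟩
    choose b hb using hch
    have h1 : ∑ s ∈ F, wt D s = ∑ s ∈ F.filter (fun s => ∃ p, s ∈ D p), wt D s := by
      symm
      apply Finset.sum_filter_of_ne
      intro s _ hs
      by_contra hc
      exact hs (by rw [wt, if_neg hc])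
    have h2 : ∑ s ∈ F.filter (fun s => ∃ p, s ∈ D p), wt D s
        = ∑ p ∈ (F.filter (fun s => ∃ p, s ∈ D p)).image b, (1/2 : ℝ) ^ p.length := by
      rw [Finset.sum_image]
      · apply Finset.sum_congr rfl
        intro s hs
        exact (hb s (Finset.mem_filter.1 hs).2).2
      · intro s hs t ht hst
        have a1 := (hb s (Finset.mem_filter.1 hs).2).1
        have a2 := (hb t (Finset.mem_filter.1 ht).2).1
        rw [hst] at a1
        exact Part.mem_unique a1 a2
    rw [h1, h2]
    apply kraft
    have hdom : ∀ p ∈ (F.filter (fun s => ∃ p, s ∈ D p)).image b, (D p).Dom := by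
      intro p hp
      obtain ⟨s, hs, rfl⟩ := Finset.mem_image.1 hp
      exact Part.dom_iff_mem.2 ⟨s, (hb s (Finset.mem_filter.1 hs).2).1⟩
    intro p hp q hq h
    exact hD p q (hdom p hp) (hdom q hq) h
  exact ⟨fun s => ⟨hnn s, by simpa using hsum {s}⟩, hsum⟩

theorem wt_lc (D : Str →. Str) (hp : Partrec D) : LowerComputable (wt D) := by
  classical
  have hnn : ∀ s, 0 ≤ wt D s := by
    intro s; rw [wt]; split_ifs <;> positivity
  obtain ⟨c, hc⟩ := Nat.Partrec.Code.exists_code.1 hp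
  have hev : ∀ (p s : Str), s ∈ D p ↔ Encodable.encode s ∈ Nat.Partrec.Code.eval c (Encodable.encode p) := by
    intro p s
    rw [hc]
    simp
  let h : ℕ → Str → ℚ := fun n s =>
    if Nat.Partrec.Code.evaln n.unpair.1 c n.unpair.2 = some (Encodable.encode s) ∧
      Encodable.encode ((Encodable.decode (α := Str) n.unpair.2).getD []) = n.unpair.2 then
      (1/2 : ℚ) ^ ((Encodable.decode (α := Str) n.unpair.2).getD []).length else 0
  have hcomp : Computable₂ h := by
    have hu : Computable (fun p : ℕ × Str => p.1.unpair) := Computable.unpair.comp Computable.fst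
    have hu1 := Computable.fst.comp hu
    have hu2 := Computable.snd.comp hu
    have hev : Computable (fun p : ℕ × Str => Nat.Partrec.Code.evaln p.1.unpair.1 c p.1.unpair.2) :=
      Nat.Partrec.Code.primrec_evaln.to_comp.comp
        (Computable.pair (Computable.pair hu1 (Computable.const c)) hu2)
    have hdec : Computable (fun p : ℕ × Str => (Encodable.decode (α := Str) p.1.unpair.2).getD []) :=
      Computable.option_getD (Computable.decode.comp hu2) (Computable.const [])
    have hlen : Computable (fun p : ℕ × Str => ((Encodable.decode (α := Str) p.1.unpair.2).getD []).length) :=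
      Computable.list_length.comp hdec
    have he1 : Computable (fun p : ℕ × Str => decide (Nat.Partrec.Code.evaln p.1.unpair.1 c p.1.unpair.2
        = some (Encodable.encode p.2))) :=
      ((Primrec.eq (α := Option ℕ)).decide.to_comp).comp hev
        (Computable.option_some.comp (Computable.encode.comp Computable.snd))
    have he2 : Computable (fun p : ℕ × Str => decide
        (Encodable.encode ((Encodable.decode (α := Str) p.1.unpair.2).getD []) = p.1.unpair.2)) :=
      cpeq (Computable.encode.comp hdec) hu2
    exact cpite (cpand he1 he2) (cqpow (Computable.const (1/2 : ℚ)) hlen) (Computable.const 0)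
  suffices hA : (∀ n s, (h n s : ℝ) ≤ wt D s) ∧ (∀ s, ∀ ε > 0, ∃ n, wt D s - ε < h n s) by
    obtain ⟨f, hf, -, hf2⟩ := runmax (r := wt D) h hcomp hnn hA.1 hA.2
    exact ⟨f, hf, hf2⟩
  refine ⟨?_, ?_⟩
  · intro n s
    simp only [h]
    split_ifs with hh
    · obtain ⟨h1, h2⟩ := hh
      have : s ∈ D ((Encodable.decode (α := Str) n.unpair.2).getD []) := by
        rw [hev, h2]
        exact Nat.Partrec.Code.evaln_sound h1
      have := wt_le D s _ this
      push_cast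
      exact this
    · simpa using hnn s
  · intro s ε hε
    by_cases hs : ∃ p, s ∈ D p
    · obtain ⟨p, hp1, hp2⟩ := wt_att D s hs
      obtain ⟨k, hk⟩ := Nat.Partrec.Code.evaln_complete.1 ((hev p s).1 hp1)
      refine ⟨Nat.pair k (Encodable.encode p), ?_⟩
      have hk' : Nat.Partrec.Code.evaln k c (Encodable.encode p) = some (Encodable.encode s) := hk
      simp only [h, Nat.unpair_pair, Encodable.encodek, Option.getD_some, hk', and_self, if_true, hp2]
      push_cast
      linarith
    · refine ⟨0, ?_⟩
      have h1 : wt D s = 0 := by rw [wt, if_neg hs]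
      have h2 : (0:ℝ) ≤ h 0 s := by
        simp only [h]; split_ifs <;> positivity
      linarith

end LowerComp

section Random

theorem le_encode_replicate (k : ℕ) : k ≤ Encodable.encode (List.replicate k true : Str) := by
  induction k with
  | zero => simp
  | succ k ih =>
    rw [List.replicate_succ, Encodable.encode_list_cons]
    exact Nat.succ_le_succ (ih.trans (Nat.right_le_pair _ _))

/-- the dyadic rational with given binary digits. -/
def vl (x : Str) : ℚ :=
  ∑ i ∈ Finset.range x.length, if x[i]? = some true then (1/2 : ℚ) ^ (i+1) else 0

theorem comp_vl : Computable vl := by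
  refine cqsum (f := fun (x : Str) (i : ℕ) => if x[i]? = some true then (1/2 : ℚ) ^ (i+1) else 0) ?_
    Computable.list_length
  have he1 : Computable (fun p : Str × ℕ => decide (p.1[p.2]? = some true)) :=
      ((Primrec.eq (α := Option Bool)).decide.to_comp).comp
        (Computable.list_getElem?.comp Computable.fst Computable.snd) (Computable.const (some true))
  exact cpite he1 (cqpow (Computable.const (1/2 : ℚ)) (Computable.succ.comp Computable.snd))
    (Computable.const 0)

theorem vl_binPrefix (T : ℝ) (n : ℕ) :
    ((vl (binPrefix T n) : ℚ) : ℝ) = ⌊Int.fract T * 2 ^ n⌋ * (1/2 : ℝ) ^ n := by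
  have h1 : ((vl (binPrefix T n) : ℚ) : ℝ) = ∑ i ∈ Finset.range n,
      if ⌊Int.fract T * 2 ^ (i + 1)⌋ % 2 = 1 then (1/2 : ℝ) ^ (i+1) else 0 := by
    rw [vl, Rat.cast_sum]
    have hl : (binPrefix T n).length = n := by simp [binPrefix]
    rw [hl]
    apply Finset.sum_congr rfl
    intro i hi
    have hi' : i < n := Finset.mem_range.1 hi
    have : (binPrefix T n)[i]? = some (decide (⌊Int.fract T * 2 ^ (i + 1)⌋ % 2 = 1)) := by
      simp [binPrefix, hi']
    rw [this]
    simp only [Option.some.injEq, decide_eq_true_eq]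
    split_ifs <;> push_cast <;> rfl
  rw [h1]
  set y := Int.fract T with hy
  clear h1
  induction n with
  | zero =>
    have : ⌊y⌋ = 0 := Int.floor_fract T
    simp [this]
  | succ n ih =>
    rw [Finset.sum_range_succ, ih]
    have e1 : y * 2 ^ (n+1) = 2 * (y * 2 ^ n) := by ring
    have a1 := Int.floor_le (y * 2 ^ n)
    have a2 := Int.lt_floor_add_one (y * 2 ^ n)
    have b1 : 2 * ⌊y * 2 ^ n⌋ ≤ ⌊y * 2 ^ (n+1)⌋ := by
      rw [Int.le_floor, e1]; push_cast; linarith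
    have b2 : ⌊y * 2 ^ (n+1)⌋ < 2 * ⌊y * 2 ^ n⌋ + 2 := by
      rw [Int.floor_lt, e1]; push_cast; linarith
    rcases (by omega : ⌊y * 2 ^ (n+1)⌋ = 2 * ⌊y * 2 ^ n⌋ ∨ ⌊y * 2 ^ (n+1)⌋ = 2 * ⌊y * 2 ^ n⌋ + 1) with h | h
    · rw [h, if_neg (by omega)]
      push_cast; ring
    · rw [h, if_pos (by omega)]
      push_cast; ring

theorem exists_prog (U : OptimalComputer) (s : Str) : ∃ p, p.length = Kc U s ∧ s ∈ U.f p := by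
  let C : Computer :=
    { f := fun p => if p = [] then Part.some s else Part.none
      partrec := by
        have : Computable (fun p : Str => if p = [] then some s else none) :=
          cpite ((Primrec.eq (α := Str)).decide.to_comp.comp Computable.id (Computable.const []))
            (Computable.const _) (Computable.const _)
        refine this.ofOption.of_eq fun p => ?_
        by_cases h : p = [] <;> simp [h]
      prefixFree := by
        have key : ∀ p : Str, (if p = [] then Part.some s else Part.none : Part Str).Dom → p = [] := by
          intro p hp
          by_contra h
          rw [if_neg h] at hp
          exact hp
        intro p q hp hq _
        rw [key p hp, key q hq] }
  obtain ⟨sim, hsim⟩ := U.optimal C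
  obtain ⟨p', hp', -⟩ := hsim [] s (by simp [C])
  have hne : {n | ∃ p : Str, p.length = n ∧ s ∈ U.f p}.Nonempty := ⟨_, p', rfl, hp'⟩
  exact Nat.sInf_mem hne

theorem sum_random (U : OptimalComputer) (m : Str → ℝ) (hm : UniversalProb m) (w : Str → ℝ)
    (f : ℕ → Str → ℚ) (hf : Computable₂ f)
    (hf2 : ∀ s : Str, (∀ n : ℕ, 0 ≤ f n s ∧ (f n s : ℝ) ≤ w s) ∧
        Tendsto (fun n => (f n s : ℝ)) atTop (nhds (w s)))
    (hsum : Summable w) (a : ℝ) (ha : 0 < a) (hw : ∀ s, a * m s ≤ w s) :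
    LeftComputableReal (∑' s, w s) ∧ ∃ c : ℕ, ∀ n : ℕ,
      (n : ℝ) - c ≤ Kc U (binPrefix (∑' s, w s) n) := by
  classical
  set T := ∑' s, w s with hT
  have hw0 : ∀ s, 0 ≤ w s := fun s => by
    have h1 := ((hf2 s).1 0).1
    have h2 := ((hf2 s).1 0).2
    have : (0:ℝ) ≤ f 0 s := by exact_mod_cast h1
    linarith
  let st : ℕ → Str := fun i => (Encodable.decode (α := Str) i).getD []
  have hst : ∀ s, st (Encodable.encode s) = s := fun s => by simp [st]
  let g : ℕ → ℕ → ℚ := fun k i => if Encodable.encode (st i) = i then f k (st i) else 0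
  let u : ℕ → ℝ := fun i => if Encodable.encode (st i) = i then w (st i) else 0
  have hu : ∀ s, u (Encodable.encode s) = w s := fun s => by simp [u, hst]
  have hu0 : ∀ i, 0 ≤ u i := fun i => by
    simp only [u]; split_ifs
    · exact hw0 _
    · exact le_rfl
  have huT : HasSum u T := by
    have h1 : HasSum w T := hsum.hasSum
    rw [← Function.Injective.hasSum_iff (Encodable.encode_injective (α := Str))]
    · exact h1.congr_fun (fun s => hu s)
    · intro x hx
      simp only [u]
      rw [if_neg]
      intro h; exact hx ⟨_, h⟩
  have hg0 : ∀ k i, 0 ≤ g k i := fun k i => by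
    simp only [g]; split_ifs
    · exact ((hf2 _).1 k).1
    · exact le_rfl
  have hgu : ∀ k i, ((g k i : ℚ) : ℝ) ≤ u i := fun k i => by
    simp only [g, u]; split_ifs
    · exact ((hf2 _).1 k).2
    · simp
  have hgt : ∀ i, Tendsto (fun k => ((g k i : ℚ) : ℝ)) atTop (nhds (u i)) := fun i => by
    simp only [g, u]; split_ifs
    · exact (hf2 _).2
    · simp
  let Tk : ℕ → ℚ := fun k => ∑ i ∈ Finset.range k, g k i
  have hTu : ∀ k, ((Tk k : ℚ) : ℝ) ≤ ∑ i ∈ Finset.range k, u i := fun k => by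
    simp only [Tk]; push_cast
    exact Finset.sum_le_sum fun i _ => hgu k i
  have huTle : ∀ F : Finset ℕ, ∑ i ∈ F, u i ≤ T := fun F =>
    sum_le_hasSum F (fun i _ => hu0 i) huT
  have hTle : ∀ k, ((Tk k : ℚ) : ℝ) ≤ T := fun k => (hTu k).trans (huTle _)
  have hTt : Tendsto (fun k => ((Tk k : ℚ) : ℝ)) atTop (nhds T) := by
    rw [tendsto_order]
    refine ⟨fun b hb => ?_, fun b hb => Eventually.of_forall fun k => (hTle k).trans_lt hb⟩
    obtain ⟨N, hN⟩ := ((tendsto_order.1 huT.tendsto_sum_nat).1 b hb).exists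
    have h1 : Tendsto (fun k => ∑ i ∈ Finset.range N, ((g k i : ℚ) : ℝ)) atTop
        (nhds (∑ i ∈ Finset.range N, u i)) := tendsto_finsetSum _ fun i _ => hgt i
    filter_upwards [(tendsto_order.1 h1).1 b hN, eventually_ge_atTop N] with k hk hkN
    refine hk.trans_le ?_
    simp only [Tk]; push_cast
    refine Finset.sum_le_sum_of_subset_of_nonneg (Finset.range_mono hkN) fun i _ _ => ?_
    exact_mod_cast hg0 k i
  have hst_c : Computable st :=
    Computable.option_getD Computable.decode (Computable.const [])
  have hTc : Computable Tk := by
    refine cqsum (f := g) ?_ Computable.id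
    have h1 : Computable (fun p : ℕ × ℕ => st p.2) := hst_c.comp Computable.snd
    have h2 : Computable (fun p : ℕ × ℕ => f p.1 (st p.2)) :=
      Computable.comp (f := fun p : ℕ × Str => f p.1 p.2) (g := fun p : ℕ × ℕ => (p.1, st p.2)) hf
        (Computable.pair Computable.fst h1)
    exact cpite (cpeq (Computable.encode.comp h1) Computable.snd) h2 (Computable.const 0)
  refine ⟨⟨fun n => - Tk n, cqneg hTc, fun n => ?_, ?_⟩, ?_⟩
  · have := hTle n; push_cast; linarith
  · have := hTt.neg; simpa using this
  -- randomness
  have hT0 : 0 ≤ T := tsum_nonneg hw0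
  let z : ℚ := (⌊T⌋ : ℤ)
  let bd : Str → ℚ := fun x => z + vl x - (1/2 : ℚ) ^ x.length
  have hbd : Computable bd := cqsub (cqadd (Computable.const z) comp_vl)
    (cqpow (Computable.const (1/2 : ℚ)) Computable.list_length)
  let P : Str → ℕ → Bool := fun x k => decide (bd x ≤ Tk k)
  have hP : Computable₂ P := cqle (f := fun p : Str × ℕ => bd p.1) (g := fun p : Str × ℕ => Tk p.2)
    (hbd.comp Computable.fst) (hTc.comp Computable.snd)
  have hR : Partrec (fun x : Str => Nat.rfind (fun k => (Part.some (P x k) : Part Bool))) :=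
    Partrec.rfind (p := fun x k => Part.some (P x k)) hP
  have hrep : Computable (fun k : ℕ => (List.replicate k true : Str)) := by
    have h3 : Computable₂ (fun (_ : ℕ) (p : ℕ × Str) => true :: p.2) :=
      Computable.list_cons.comp (Computable.const true) (Computable.snd.comp Computable.snd)
    refine (Computable.nat_rec (f := fun k : ℕ => k) Computable.id (Computable.const ([] : Str)) h3).of_eq
      fun k => ?_
    induction k with
    | zero => rfl
    | succ k ih => simp only at ih ⊢; rw [ih, List.replicate_succ]
  let G : Str →. Str := fun x => (Nat.rfind (fun k => (Part.some (P x k) : Part Bool))).map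
    (fun k => List.replicate k true)
  have hG : Partrec G := hR.map (hrep.comp Computable.snd)
  let D : Str →. Str := fun p => (U.f p).bind G
  have hD : Partrec D := U.partrec.bind (hG.comp Computable.snd)
  have hDpf : ∀ p q : Str, (D p).Dom → (D q).Dom → p <+: q → p = q := by
    intro p q hp hq h
    exact U.prefixFree p q hp.1 hq.1 h
  obtain ⟨C, hC, hCm⟩ := hm.2 (wt D) ⟨wt_semi D hDpf, wt_lc D hD⟩
  obtain ⟨c, hc⟩ := exists_pow_lt_of_lt_one (show (0:ℝ) < a * C / 2 by positivity)
    (show (1/2 : ℝ) < 1 by norm_num)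
  refine ⟨c, fun n => ?_⟩
  set x := binPrefix T n with hx
  have hxl : x.length = n := by simp [hx, binPrefix]
  obtain ⟨p, hpl, hpx⟩ := exists_prog U x
  have hv := vl_binPrefix T n
  rw [← hx] at hv
  have a1 := Int.floor_le (Int.fract T * 2 ^ n)
  have a2 := Int.lt_floor_add_one (Int.fract T * 2 ^ n)
  have hpn : (0:ℝ) < (1/2 : ℝ) ^ n := by positivity
  have hpp : (2:ℝ) ^ n * (1/2 : ℝ) ^ n = 1 := by rw [← mul_pow]; norm_num
  have b1 : ((vl x : ℚ) : ℝ) ≤ Int.fract T := by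
    rw [hv]
    calc _ ≤ (Int.fract T * 2 ^ n) * (1/2 : ℝ) ^ n := by gcongr
      _ = Int.fract T := by rw [mul_assoc, hpp, mul_one]
  have b2 : Int.fract T ≤ ((vl x : ℚ) : ℝ) + (1/2 : ℝ) ^ n := by
    rw [hv]
    calc Int.fract T = (Int.fract T * 2 ^ n) * (1/2 : ℝ) ^ n := by rw [mul_assoc, hpp, mul_one]
      _ ≤ (⌊Int.fract T * 2 ^ n⌋ + 1) * (1/2 : ℝ) ^ n := by gcongr
      _ = _ := by ring
  have hfr : T = ⌊T⌋ + Int.fract T := (Int.floor_add_fract T).symm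
  have hbdr : ((bd x : ℚ) : ℝ) = ⌊T⌋ + (vl x : ℚ) - (1/2 : ℝ) ^ n := by
    simp only [bd, z, hxl]; push_cast; ring
  have hex : ∃ k, P x k = true := by
    have : ((bd x : ℚ) : ℝ) < T := by rw [hbdr]; linarith
    obtain ⟨k, hk⟩ := ((tendsto_order.1 hTt).1 _ this).exists
    refine ⟨k, ?_⟩
    simp only [P, decide_eq_true_eq]
    exact_mod_cast hk.le
  obtain ⟨k0, hk0⟩ := hex
  obtain ⟨k, hk, -⟩ := Nat.rfind_min' (p := P x) hk0
  have hkP : bd x ≤ Tk k := by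
    have := Nat.rfind_spec hk
    have h2 : P x k = true := by simpa using this
    simpa only [P, decide_eq_true_eq] using h2
  set s : Str := List.replicate k true with hs
  have hsD : s ∈ D p := by
    refine Part.mem_bind hpx ?_
    exact Part.mem_map (fun k => (List.replicate k true : Str)) hk
  have c1 := wt_le D s p hsD
  have c2 := hCm s
  have c3 := hw s
  have hkP' : ((bd x : ℚ) : ℝ) ≤ ((Tk k : ℚ) : ℝ) := by exact_mod_cast hkP
  have c4 : w s + ((Tk k : ℚ) : ℝ) ≤ T := by
    have h1 := huTle (insert (Encodable.encode s) (Finset.range k))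
    rw [Finset.sum_insert (by simpa using le_encode_replicate k), hu] at h1
    have := hTu k
    linarith
  have c5 : w s ≤ 2 * (1/2 : ℝ) ^ n := by linarith
  rw [hpl] at c1
  have hK : (0:ℝ) < (1/2 : ℝ) ^ (Kc U x) := by positivity
  have c6 : a * (C * (1/2 : ℝ) ^ (Kc U x)) ≤ 2 * (1/2 : ℝ) ^ n :=
    calc a * (C * (1/2 : ℝ) ^ (Kc U x)) ≤ a * (C * wt D s) := by gcongr
      _ ≤ a * m s := by gcongr
      _ ≤ _ := c3.trans c5
  have c7 : (1/2 : ℝ) ^ (c + Kc U x) < (1/2 : ℝ) ^ n := by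
    rw [pow_add]
    have := mul_lt_mul_of_pos_right hc hK
    nlinarith
  have c8 : n < c + Kc U x := by
    by_contra hcon
    push Not at hcon
    exact absurd c7 (not_lt.2 (pow_le_pow_of_le_one (by norm_num) (by norm_num) hcon))
  have c9 : (n:ℝ) ≤ c + Kc U x := by exact_mod_cast c8.le
  linarith

end Random

section Tsallis

theorem ql_real (x y ql : ℚ) (hx : 0 ≤ x) (hy : 0 ≤ y) (hql : 1 ≤ qp ql) :
    x ^ (qp ql) ≤ y ^ ql.den ↔ (x : ℝ) ^ (ql : ℝ) ≤ (y : ℝ) := by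
  have hx' : (0:ℝ) ≤ x := by exact_mod_cast hx
  have hy' : (0:ℝ) ≤ y := by exact_mod_cast hy
  have hd : (ql.den : ℝ) ≠ 0 := by exact_mod_cast ql.den_nz
  have hqn : qn ql = 0 := by
    unfold qp at hql; unfold qn; omega
  have e1 : (ql : ℝ) * ql.den = qp ql := by
    have := q_eq ql
    rw [hqn] at this
    have h2 : ql * ql.den = qp ql := by
      have hd' : (ql.den : ℚ) ≠ 0 := by exact_mod_cast ql.den_nz
      rw [eq_div_iff hd'] at this
      simpa using this
    exact_mod_cast h2
  have e2 : ((x : ℝ) ^ (ql : ℝ)) ^ ql.den = (x : ℝ) ^ (qp ql) := by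
    rw [← Real.rpow_natCast, ← Real.rpow_mul hx', e1, Real.rpow_natCast]
  have e3 : x ^ (qp ql) ≤ y ^ ql.den ↔ (x : ℝ) ^ (qp ql) ≤ (y : ℝ) ^ ql.den := by
    exact_mod_cast Iff.rfl
  rw [e3, ← e2]
  exact pow_le_pow_iff_left₀ (Real.rpow_nonneg hx' _) hy' ql.den_nz

theorem M_pow {q x : ℝ} (hq : 1 < q) (hx : 0 ≤ x) (hxM : x ≤ q ^ (1 / (1 - q))) :
    x ^ (q - 1) ≤ 1 / q := by
  calc x ^ (q-1) ≤ (q ^ (1 / (1 - q))) ^ (q - 1) := Real.rpow_le_rpow hx hxM (by linarith)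
    _ = q ^ (-1 : ℝ) := by
      rw [← Real.rpow_mul (by linarith)]
      congr 1
      have : 1 - q ≠ 0 := by linarith
      field_simp; ring
    _ = 1 / q := by rw [Real.rpow_neg_one, one_div]

theorem F_lower {q x : ℝ} (hq : 1 < q) (hx : 0 ≤ x) (hxM : x ≤ q ^ (1 / (1 - q))) :
    (1 / q) * x ≤ (1 / (q - 1)) * (x - x ^ q) := by
  have h := M_pow hq hx hxM
  have e : x ^ q = x * x ^ (q - 1) := by
    rcases hx.eq_or_lt with rfl | hx0
    · rw [Real.zero_rpow (by linarith)]; simp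
    · rw [← Real.rpow_one_add' hx (by linarith)]; congr 1; ring
  have h1 : x * x ^ (q - 1) ≤ x * (1 / q) := mul_le_mul_of_nonneg_left h hx
  have hq1 : 0 < q - 1 := by linarith
  rw [e, one_div_mul_eq_div (q - 1), le_div_iff₀ hq1]
  have : 1 / q * x * (q - 1) = x - x * (1 / q) := by field_simp
  linarith

theorem F_mono {q x y : ℝ} (hq : 1 < q) (hx : 0 ≤ x) (hxy : x ≤ y) (hyM : y ≤ q ^ (1 / (1 - q))) :
    x - x ^ q ≤ y - y ^ q := by
  rcases (hx.trans hxy).eq_or_lt with h0 | hy0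
  · have : x = y := by linarith
    rw [this]
  have h := M_pow hq hy0.le hyM
  have hb := one_add_mul_self_le_rpow_one_add (s := x / y - 1)
    (by have := div_nonneg hx hy0.le; linarith) hq.le
  rw [show 1 + (x / y - 1) = x / y by ring, Real.div_rpow hx hy0.le,
    le_div_iff₀ (Real.rpow_pos_of_pos hy0 q)] at hb
  have e : y ^ q = y * y ^ (q - 1) := by
    rw [← Real.rpow_one_add' hy0.le (by linarith)]; congr 1; ring
  have hp : 0 < y ^ (q - 1) := Real.rpow_pos_of_pos hy0 _
  have e2 : (1 + q * (x / y - 1)) * y ^ q = y ^ q - q * (y - x) * y ^ (q - 1) := by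
    rw [e]; field_simp; ring
  rw [e2] at hb
  have h3 : (y - x) * (q * y ^ (q - 1)) ≤ (y - x) * 1 := by
    apply mul_le_mul_of_nonneg_left _ (by linarith)
    rw [le_div_iff₀ (by linarith)] at h; linarith
  linarith

theorem tsallis_lc {m : Str → ℝ} {q : ℝ} (hm0 : ∀ s, 0 ≤ m s) (hm1 : ∀ s, m s ≤ 1)
    (hmc : LowerComputable m) (hqc : ComputableReal q) (hq : 1 < q)
    (hbound : ∀ s : Str, m s ≤ q ^ (1 / (1 - q))) :
    LowerComputable (fun s => (1 / (q - 1)) * (m s - m s ^ q)) := by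
  obtain ⟨f, hf, hf2⟩ := hmc
  obtain ⟨fq, hfq, hfq2⟩ := hqc
  have hq1 : 0 < q - 1 := by linarith
  let ql : ℕ → ℚ := fun k => fq k - (1/2 : ℚ) ^ k
  let qh : ℕ → ℚ := fun k => fq k + (1/2 : ℚ) ^ k
  have hhalf : Tendsto (fun k : ℕ => (1/2 : ℝ) ^ k) atTop (nhds 0) :=
    tendsto_pow_atTop_nhds_zero_of_lt_one (by norm_num) (by norm_num)
  have hql : ∀ k, ((ql k : ℚ) : ℝ) < q := fun k => by
    have := abs_lt.1 (hfq2 k)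
    simp only [ql]; push_cast; rw [one_div]; linarith
  have hqh : ∀ k, q < ((qh k : ℚ) : ℝ) := fun k => by
    have := abs_lt.1 (hfq2 k)
    simp only [qh]; push_cast; rw [one_div]; linarith
  have hfqt : Tendsto (fun k => ((fq k : ℚ) : ℝ)) atTop (nhds q) := by
    have h1 : ∀ k, q - (1/2 : ℝ) ^ k ≤ fq k := fun k => by
      have := abs_lt.1 (hfq2 k); rw [one_div]; linarith
    have h2 : ∀ k, (fq k : ℝ) ≤ q + (1/2 : ℝ) ^ k := fun k => by
      have := abs_lt.1 (hfq2 k); rw [one_div]; linarith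
    refine tendsto_of_tendsto_of_tendsto_of_le_of_le ?_ ?_ h1 h2
    · simpa using tendsto_const_nhds.sub hhalf
    · simpa using tendsto_const_nhds.add hhalf
  have hqlt : Tendsto (fun k => ((ql k : ℚ) : ℝ)) atTop (nhds q) := by
    have := hfqt.sub hhalf
    simp only [ql]; push_cast; simpa using this
  have hqht : Tendsto (fun k => ((qh k : ℚ) : ℝ)) atTop (nhds q) := by
    have := hfqt.add hhalf
    simp only [qh]; push_cast; simpa using this
  let h : ℕ → Str → ℚ := fun n s =>
    if 1 ≤ qp (ql n.unpair.1) ∧ 0 ≤ Denumerable.ofNat ℚ n.unpair.2 ∧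
      Denumerable.ofNat ℚ n.unpair.2 ≤ f n.unpair.1 s ∧
      (f n.unpair.1 s) ^ (qp (ql n.unpair.1)) ≤ (Denumerable.ofNat ℚ n.unpair.2) ^ (ql n.unpair.1).den
    then (f n.unpair.1 s - Denumerable.ofNat ℚ n.unpair.2) / (qh n.unpair.1 - 1) else 0
  have hcomp : Computable₂ h := by
    have hu : Computable (fun p : ℕ × Str => p.1.unpair) := Computable.unpair.comp Computable.fst
    have hu1 : Computable (fun p : ℕ × Str => p.1.unpair.1) := Computable.fst.comp hu
    have hu2 : Computable (fun p : ℕ × Str => p.1.unpair.2) := Computable.snd.comp hu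
    have hy : Computable (fun p : ℕ × Str => Denumerable.ofNat ℚ p.1.unpair.2) :=
      (Primrec.ofNat ℚ).to_comp.comp hu2
    have hx : Computable (fun p : ℕ × Str => f p.1.unpair.1 p.2) :=
      Computable.comp (f := fun p : ℕ × Str => f p.1 p.2)
        (g := fun p : ℕ × Str => (p.1.unpair.1, p.2)) hf (Computable.pair hu1 Computable.snd)
    have hqlc : Computable ql := cqsub hfq (cqpow (Computable.const (1/2 : ℚ)) Computable.id)
    have hqhc : Computable qh := cqadd hfq (cqpow (Computable.const (1/2 : ℚ)) Computable.id)
    have hQl : Computable (fun p : ℕ × Str => ql p.1.unpair.1) := hqlc.comp hu1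
    have hQh : Computable (fun p : ℕ × Str => qh p.1.unpair.1) := hqhc.comp hu1
    exact cpite (cpand (cple (Computable.const 1) (comp_qp.comp hQl))
      (cpand (cqle (Computable.const 0) hy) (cpand (cqle hy hx)
        (cqle (cqpow hx (comp_qp.comp hQl)) (cqpow hy (comp_den.comp hQl))))))
      (cqdiv (cqsub hx hy) (cqsub hQh (Computable.const 1))) (Computable.const 0)
  have hr0 : ∀ s, 0 ≤ (1 / (q - 1)) * (m s - m s ^ q) := fun s =>
    le_trans (mul_nonneg (by positivity) (hm0 s)) (F_lower hq (hm0 s) (hbound s))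
  suffices hA : (∀ n s, (h n s : ℝ) ≤ (1 / (q - 1)) * (m s - m s ^ q)) ∧
      (∀ s, ∀ ε > 0, ∃ n, (1 / (q - 1)) * (m s - m s ^ q) - ε < h n s) by
    obtain ⟨f, hf, -, hf2⟩ := runmax (r := fun s => (1 / (q - 1)) * (m s - m s ^ q)) h hcomp hr0 hA.1 hA.2
    exact ⟨f, hf, hf2⟩
  refine ⟨?_, ?_⟩
  · intro n s
    simp only [h]
    split_ifs with hc
    · obtain ⟨h1, h2, h3, h4⟩ := hc
      generalize Denumerable.ofNat ℚ n.unpair.2 = y at *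
      generalize n.unpair.1 = k at *
      have hx := (hf2 s).1 k
      rw [ql_real _ _ _ hx.1 h2 h1] at h4
      have hx0 : (0:ℝ) ≤ f k s := by exact_mod_cast hx.1
      have hql0 : (0:ℝ) ≤ ql k := by
        have : 0 ≤ ql k := by
          unfold qp at h1
          rw [← Rat.num_nonneg]; omega
        exact_mod_cast this
      have h5 : (f k s : ℝ) ^ q ≤ y :=
        (Real.rpow_le_rpow_of_exponent_ge' hx0 (hx.2.trans (hm1 s)) hql0 (hql k).le).trans h4
      have h3' : (y:ℝ) ≤ f k s := by exact_mod_cast h3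
      have h6 := F_mono hq hx0 hx.2 (hbound s)
      push_cast
      rw [one_div_mul_eq_div]
      have := hqh k
      apply div_le_div₀ <;> linarith
    · simpa using hr0 s
  · intro s ε hε
    rcases (hm0 s).eq_or_lt with h0 | h0
    · refine ⟨0, ?_⟩
      have h2 : (0:ℝ) ≤ h 0 s := by
        have : (0:ℚ) ≤ h 0 s := by
          simp only [h]; split_ifs with hc
          · apply div_nonneg
            · linarith [hc.2.2.1]
            · have := hqh (Nat.unpair 0).1
              have h3 : (1:ℝ) < (qh (Nat.unpair 0).1 : ℚ) := by linarith
              have : (1:ℚ) < qh (Nat.unpair 0).1 := by exact_mod_cast h3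
              linarith
          · exact le_rfl
        exact_mod_cast this
      rw [← h0, Real.zero_rpow (by linarith)]
      simp; linarith
    · have hlow := F_lower hq (hm0 s) (hbound s)
      have hlt : m s ^ q < m s := by
        have h1 : 0 < (1 / (q - 1)) * (m s - m s ^ q) := lt_of_lt_of_le (by positivity) hlow
        have := (mul_pos_iff_of_pos_left (by positivity : 0 < 1 / (q - 1))).1 h1
        linarith
      obtain ⟨y, hy1, hy2⟩ := exists_rat_btwn (show m s ^ q < min (m s) (m s ^ q + ε * (q - 1)) from
        lt_min hlt (by nlinarith))
      have hy3 := (lt_min_iff.1 hy2).1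
      have hy4 := (lt_min_iff.1 hy2).2
      have hmt := (hf2 s).2
      have t1 : Tendsto (fun k => (f k s : ℝ) ^ ((ql k : ℚ) : ℝ)) atTop (nhds (m s ^ q)) :=
        hmt.rpow hqlt (Or.inl h0.ne')
      have t2 : Tendsto (fun k => ((f k s : ℝ) - y) / (((qh k : ℚ) : ℝ) - 1)) atTop
          (nhds ((m s - y) / (q - 1))) :=
        (hmt.sub tendsto_const_nhds).div (hqht.sub tendsto_const_nhds) hq1.ne'
      have t3 : (1 / (q - 1)) * (m s - m s ^ q) - ε < (m s - y) / (q - 1) := by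
        rw [lt_div_iff₀ hq1]
        have : (1 / (q - 1) * (m s - m s ^ q) - ε) * (q - 1) = m s - m s ^ q - ε * (q - 1) := by
          field_simp
        linarith
      obtain ⟨k, k1, k2, k3, k4⟩ := ((tendsto_order.1 t1).2 _ hy1 |>.and
        (((tendsto_order.1 t2).1 _ t3).and (((tendsto_order.1 hmt).1 _ hy3).and
        ((tendsto_order.1 hqlt).1 0 (by linarith))))).exists
      refine ⟨Nat.pair k (@Encodable.encode ℚ Primcodable.toEncodable y), ?_⟩
      have hy0 : 0 ≤ y := by
        have h1 : (0:ℝ) ≤ m s ^ q := Real.rpow_nonneg h0.le _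
        have : (0:ℝ) < y := by linarith
        exact_mod_cast this.le
      have e : Denumerable.ofNat ℚ (@Encodable.encode ℚ Primcodable.toEncodable y) = y :=
        Denumerable.ofNat_encode y
      have hq1' : 1 ≤ qp (ql k) := by
        have : 0 < ql k := by exact_mod_cast k4
        rw [← Rat.num_pos] at this
        unfold qp; omega
      have hcc : 1 ≤ qp (ql k) ∧ 0 ≤ y ∧ y ≤ f k s ∧ (f k s) ^ (qp (ql k)) ≤ y ^ (ql k).den :=
        ⟨hq1', hy0, by exact_mod_cast k3.le, (ql_real _ _ _ ((hf2 s).1 k).1 hy0 hq1').2 k1.le⟩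
      simp only [h, Nat.unpair_pair, e]
      rw [if_pos hcc]
      push_cast
      exact k2

end Tsallis

/-- If `m` is a universal probability, `q > 1` is computable, and
`m s ≤ q^(1/(1-q))` for all `s`, then the Tsallis entropy `S_q(m)` is
left-computable and weakly Chaitin random. -/
theorem tsallis_entropy_random_of_small (U : OptimalComputer)
    (m : Str → ℝ) (hm : UniversalProb m)
    (q : ℝ) (hqc : ComputableReal q) (hq : 1 < q)
    (hbound : ∀ s : Str, m s ≤ q ^ (1 / (1 - q))) :
    LeftComputableReal ((1 / (q - 1)) * ∑' s, (m s - m s ^ q)) ∧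
    ∃ c : ℕ, ∀ n : ℕ,
      (n : ℝ) - c ≤ Kc U (binPrefix ((1 / (q - 1)) * ∑' s, (m s - m s ^ q)) n) := by


  have hm0 : ∀ s, 0 ≤ m s := fun s => (hm.1.1.1 s).1
  have hm1 : ∀ s, m s ≤ 1 := fun s => (hm.1.1.1 s).2
  have hq1 : 0 < q - 1 := by linarith
  have hsm : Summable m := summable_of_sum_le hm0 hm.1.1.2
  obtain ⟨f, hf, hf2⟩ := tsallis_lc hm0 hm1 hm.1.2 hqc hq hbound
  have hlow : ∀ s, (1 / q) * m s ≤ (1 / (q - 1)) * (m s - m s ^ q) := fun s =>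
    F_lower hq (hm0 s) (hbound s)
  have hsum : Summable (fun s => (1 / (q - 1)) * (m s - m s ^ q)) := by
    refine Summable.of_nonneg_of_le (fun s => le_trans (mul_nonneg (by positivity) (hm0 s)) (hlow s))
      (fun s => ?_) (hsm.mul_left (1 / (q - 1)))
    have := Real.rpow_nonneg (hm0 s) q
    apply mul_le_mul_of_nonneg_left _ (by positivity)
    linarith
  rw [← tsum_mul_left]
  exact sum_random U m hm _ f hf hf2 hsum (1 / q) (by positivity) hlow

end Paper
end
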